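/- Let X ⊂ P^r be an integral nondegenerate variety with generic rank 2 whose general entry locus Γ_q(X) is irreducible (type I). Then X is of type A if and only if ℓ(X) = γ(X) + 1, i.e. the entry locus is a hypersurface in its linear span. -/

import Mathlib

open MvPolynomial

noncomputable section

namespace EL

variable {k : Type} [Field k] {n : ℕ}

/-- Projective space of (vector) dimension `n` over `k`. -/
abbrev PS (k : Type) [Field k] (n : ℕ) : Type := Projectivization k (Fin n → k)

/-- Projective vanishing set of a polynomial (intended to be homogeneous). -/
def V0 (f : MvPolynomial (Fin n) k) : Set (PS k n) :=
  {p | ∀ (v : Fin n → k) (hv : v ≠ 0), Projectivization.mk k v hv = p → eval v f = 0}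

/-- The Zariski topology on projective space, generated by complements of vanishing
sets of homogeneous polynomials. -/
instance : TopologicalSpace (PS k n) :=
  TopologicalSpace.generateFrom
    {U | ∃ (d : ℕ) (f : MvPolynomial (Fin n) k), f.IsHomogeneous d ∧ U = (V0 f)ᶜ}

/-- The linear span (as a submodule of the cone) of a set of projective points. -/
def pspan (S : Set (PS k n)) : Submodule k (Fin n → k) := ⨆ p ∈ S, p.submodule

/-- The projective linear subspace associated to a submodule. -/
def linSet (W : Submodule k (Fin n → k)) : Set (PS k n) := {p | p.submodule ≤ W}

/-- `q` lies in the projective span of `S`. -/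
def memSpan (q : PS k n) (S : Set (PS k n)) : Prop := q.submodule ≤ pspan S

/-- The projective dimension of the span of `S`. -/
def spanDim (S : Set (PS k n)) : ℕ := Module.finrank k ↥(pspan S) - 1

/-- `S` is nondegenerate (spans the ambient projective space). -/
def Nondeg (S : Set (PS k n)) : Prop := pspan S = ⊤

/-- `S` is a projective linear subspace of projective dimension `d`. -/
def IsLin (S : Set (PS k n)) (d : ℕ) : Prop :=
  ∃ W : Submodule k (Fin n → k), Module.finrank k ↥W = d + 1 ∧ S = linSet W

/-- Dimension of a subset, as topological Krull dimension. -/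
def pdim (S : Set (PS k n)) : WithBot ℕ∞ := topologicalKrullDim ↥S

/-- An integral (sub)variety: an irreducible Zariski-closed set. -/
def IsVariety (S : Set (PS k n)) : Prop := IsClosed S ∧ IsIrreducible S

/-- A property holds for a general point of projective space. -/
def Generic (P : PS k n → Prop) : Prop :=
  ∃ U : Set (PS k n), IsOpen U ∧ Dense U ∧ ∀ q ∈ U, P q

/-- A property holds for a general point of the set `S`. -/
def GenericIn (S : Set (PS k n)) (P : PS k n → Prop) : Prop :=
  ∃ U : Set (PS k n), IsOpen U ∧ S ⊆ closure (S ∩ U) ∧ ∀ q ∈ S ∩ U, P q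

/-- A property holds for a general tuple of points of projective space. -/
def GenericP {ι : Type} (P : (ι → PS k n) → Prop) : Prop :=
  ∃ U : Set (ι → PS k n), IsOpen U ∧ Dense U ∧ ∀ z ∈ U, P z

/-- `q` is spanned by some `s` points of `X`. -/
def hasDecomp (X : Set (PS k n)) (q : PS k n) (s : ℕ) : Prop :=
  ∃ A : Finset (PS k n), ↑A ⊆ X ∧ A.card = s ∧ memSpan q ↑A

/-- The `X`-rank of a point `q`. -/
def rk (X : Set (PS k n)) (q : PS k n) : ℕ := sInf {s | hasDecomp X q s}

/-- `A` irredundantly spans `q`. -/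
def Irredundant (q : PS k n) (A : Finset (PS k n)) : Prop :=
  memSpan q ↑A ∧ ∀ B : Finset (PS k n), B ⊂ A → ¬ memSpan q ↑B

/-- The set `𝒮(X,q)` of minimal irredundant decompositions of `q` by points of `X`. -/
def decomps (X : Set (PS k n)) (q : PS k n) : Set (Finset (PS k n)) :=
  {A | ↑A ⊆ X ∧ A.card = rk X q ∧ Irredundant q A}

/-- The entry locus of `q` with respect to `X`. -/
def entryLocus (X : Set (PS k n)) (q : PS k n) : Set (PS k n) :=
  closure (⋃ A ∈ decomps X q, (↑A : Set (PS k n)))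

/-- The `s`-th secant variety of `X`. -/
def secant (X : Set (PS k n)) (s : ℕ) : Set (PS k n) :=
  closure {q | hasDecomp X q s}

/-- The generic `X`-rank: least `s` whose secant fills the span of `X`. -/
def rgen (X : Set (PS k n)) : ℕ := sInf {s | secant X s = linSet (pspan X)}

/-- Type I: the general entry locus is irreducible. -/
def TypeI (X : Set (PS k n)) : Prop := Generic (fun q => IsIrreducible (entryLocus X q))

/-- Type II: the general entry locus is reducible. -/
def TypeII (X : Set (PS k n)) : Prop := Generic (fun q => ¬ IsIrreducible (entryLocus X q))

/-- Type A: the entry locus does not change at a general point of its span. -/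
def TypeA (X : Set (PS k n)) : Prop :=
  Generic (fun q => GenericIn (linSet (pspan (entryLocus X q)))
    (fun o => entryLocus X o = entryLocus X q))

/-- `S` (of dimension `m`) has degree `d`: `d` is the largest finite number of points cut
on `S` by a linear subspace of complementary dimension. -/
def HasDegree (S : Set (PS k n)) (m d : ℕ) : Prop :=
  IsGreatest {t | ∃ L : Set (PS k n), IsLin L (n - 1 - m) ∧ (S ∩ L).Finite ∧
    (S ∩ L).ncard = t} d

/-- All secant varieties of `Y` (of dimension `m`) have the expected dimension. -/
def NonDefective (Y : Set (PS k n)) (m : ℕ) : Prop :=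
  ∀ s : ℕ, 1 ≤ s →
    pdim (secant Y s) = ((min ((m+1)*s - 1) (spanDim Y) : ℕ) : WithBot ℕ∞)

/-- `π_o(T) ⊆ π_o(Y)`: every point of `T` (other than `o`) is collinear with `o`
and a point of `Y`. -/
def projLE (o : PS k n) (T Y : Set (PS k n)) : Prop :=
  ∀ t ∈ T, t ≠ o → ∃ y ∈ Y, t.submodule ≤ o.submodule ⊔ y.submodule

/-- A Segre point of the pair `(Y,T)`: projection from `o` maps `Y` and `T`
onto the same set. -/
def SegrePtPair (Y T : Set (PS k n)) (o : PS k n) : Prop :=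
  o ∉ Y ∪ T ∧ projLE o Y T ∧ projLE o T Y

/-- A Segre point of `Y`: the projection from `o` is non-birational on `Y`
(it is not generically injective). -/
def SegrePt (Y : Set (PS k n)) (o : PS k n) : Prop :=
  o ∉ Y ∧ ¬ GenericIn Y (fun y => ∀ y' ∈ Y, y'.submodule ≤ o.submodule ⊔ y.submodule → y' = y)

/-- The Segre locus of `Y`. -/
def segreLocus (Y : Set (PS k n)) : Set (PS k n) := closure {o | SegrePt Y o}

/-- `X` is a cone with vertex `v`. -/
def IsCone (X : Set (PS k n)) (v : PS k n) : Prop :=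
  ∀ p ∈ X, ∀ q : PS k n, q.submodule ≤ v.submodule ⊔ p.submodule → q ∈ X

/-- The homogeneous polynomials vanishing on `X`. -/
def homogCut (X : Set (PS k n)) : Set (MvPolynomial (Fin n) k) :=
  {f | (∃ d, f.IsHomogeneous d) ∧ X ⊆ V0 f}

/-- The span of the gradients at `p` of homogeneous polynomials vanishing on `X`. -/
def gradSpan (X : Set (PS k n)) (p : PS k n) : Submodule k (Fin n → k) :=
  Submodule.span k ((fun f => fun i => eval p.rep (pderiv i f)) '' homogCut X)

/-- Smoothness at a point of an `m`-dimensional subvariety (Jacobian criterion). -/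
def IsSmoothPt (X : Set (PS k n)) (m : ℕ) (p : PS k n) : Prop :=
  Module.finrank k ↥(gradSpan X p) = n - (m + 1)

/-- `X` (of dimension `m`) has only isolated singularities. -/
def IsolatedSings (X : Set (PS k n)) (m : ℕ) : Prop :=
  {p ∈ X | ¬ IsSmoothPt X m p}.Finite

/-- `X` (of dimension `m`) is smooth. -/
def IsSmoothVar (X : Set (PS k n)) (m : ℕ) : Prop := ∀ p ∈ X, IsSmoothPt X m p

/-- The hyperplane (as a submodule) determined by a point of the dual projective space. -/
def hypSub (a : PS k n) : Submodule k (Fin n → k) :=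
  LinearMap.ker (∑ i, a.rep i • (LinearMap.proj i : (Fin n → k) →ₗ[k] k))

/-- The hyperplane determined by a point of the dual projective space. -/
def hypOf (a : PS k n) : Set (PS k n) := linSet (hypSub a)

/-- The (geometric) genus of a space curve `C`, defined by the node count of a
projection from a general point of its span: a general point of `⟨C⟩` lies on
`(d-1)(d-2)/2 - g` secant lines of `C`. -/
def HasGenus (C : Set (PS k n)) (g : ℕ) : Prop :=
  ∃ d : ℕ, HasDegree C 1 d ∧
    GenericIn (linSet (pspan C)) (fun q =>
      2 * (decomps C q).ncard + 2 * g + 3 * d = d * d + 2)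

/-- The embedded tangent space of `X` at `p` (as a submodule of the cone). -/
def tangentSub (X : Set (PS k n)) (p : PS k n) : Submodule k (Fin n → k) :=
  ⨅ f ∈ homogCut X,
    LinearMap.ker (∑ i, (eval p.rep (pderiv i f)) • (LinearMap.proj i : (Fin n → k) →ₗ[k] k))

/-- A curve is tangentially degenerate if its general tangent line meets the
curve elsewhere. -/
def TangDeg (X : Set (PS k n)) : Prop :=
  GenericIn {p ∈ X | IsSmoothPt X 1 p}
    (fun p => ∃ y ∈ X, y ≠ p ∧ y.submodule ≤ tangentSub X p)

/-- The homogeneous ideal of `X`. -/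
def projIdeal (X : Set (PS k n)) : Ideal (MvPolynomial (Fin n) k) :=
  Ideal.span {f | X ⊆ V0 f}

/-- `X` is a normal variety: its homogeneous coordinate ring is integrally closed
in its total fraction ring. -/
def IsNormalVar (X : Set (PS k n)) : Prop :=
  ∀ x : FractionRing (MvPolynomial (Fin n) k ⧸ projIdeal X),
    IsIntegral (MvPolynomial (Fin n) k ⧸ projIdeal X) x →
      ∃ y : MvPolynomial (Fin n) k ⧸ projIdeal X,
        algebraMap (MvPolynomial (Fin n) k ⧸ projIdeal X)
          (FractionRing (MvPolynomial (Fin n) k ⧸ projIdeal X)) y = x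

/-- `C` is an irreducible component of `Y`. -/
def IsCompOf (C Y : Set (PS k n)) : Prop :=
  Maximal (fun Z => Z ⊆ Y ∧ IsIrreducible Z) C

/-- The image of `X` under the linear projection from (the linear space of) `W`,
realized inside the complementary linear space of `Λ`. -/
def projFrom (W Λ : Submodule k (Fin n → k)) (X : Set (PS k n)) : Set (PS k n) :=
  {y | y.submodule ≤ Λ ∧ ∃ x ∈ X, y.submodule ≤ W ⊔ x.submodule}

/-- Decompositions of `q` as irredundant spans of one point from each `Xs i`. -/
def tupleDecomps {s : ℕ} (Xs : Fin s → Set (PS k n)) (q : PS k n) :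
    Set (Fin s → PS k n) :=
  {p | (∀ i, p i ∈ Xs i) ∧ Function.Injective p ∧ memSpan q (Set.range p) ∧
    ∀ i, ¬ memSpan q (Set.range p \ {p i})}

/-- The entry locus of `q` with respect to the tuple of varieties `Xs`. -/
def entryLocusT {s : ℕ} (Xs : Fin s → Set (PS k n)) (q : PS k n) : Set (PS k n) :=
  closure (⋃ p ∈ tupleDecomps Xs q, Set.range p)

/-- The join of the varieties `Xs`. -/
def joinT {s : ℕ} (Xs : Fin s → Set (PS k n)) : Set (PS k n) :=
  closure {q | ∃ p : Fin s → PS k n, (∀ i, p i ∈ Xs i) ∧ memSpan q (Set.range p)}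

/-- Relation `q = F(p)` for a tuple `F` of homogeneous polynomials of the same degree. -/
def polyMapRel {N M : ℕ} (F : Fin M → MvPolynomial (Fin N) k) (p : PS k N) (q : PS k M) :
    Prop :=
  q.submodule = Submodule.span k {fun j => eval p.rep (F j)}

/-- `A` and `B` are isomorphic via mutually inverse polynomial maps. -/
def IsPolyIso {N M : ℕ} (A : Set (PS k N)) (B : Set (PS k M)) : Prop :=
  ∃ (d e : ℕ) (F : Fin M → MvPolynomial (Fin N) k) (G : Fin N → MvPolynomial (Fin M) k),
    (∀ j, (F j).IsHomogeneous d) ∧ (∀ i, (G i).IsHomogeneous e) ∧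
    (∀ p ∈ A, ∃ q ∈ B, polyMapRel F p q ∧ polyMapRel G q p) ∧
    (∀ q ∈ B, ∃ p ∈ A, polyMapRel F p q ∧ polyMapRel G q p)

/-- `A` and `B` are birational: polynomially isomorphic on dense open subsets. -/
def Birational (A B : Set (PS k n)) : Prop :=
  ∃ U V : Set (PS k n), IsOpen U ∧ IsOpen V ∧
    A ⊆ closure (A ∩ U) ∧ B ⊆ closure (B ∩ V) ∧ IsPolyIso (A ∩ U) (B ∩ V)

/-- A finite set `S` imposes independent conditions on hypersurfaces of degree `i`. -/
def ImposesIndep (S : Finset (PS k n)) (i : ℕ) : Prop :=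
  Function.Surjective (fun f : ↥(homogeneousSubmodule (Fin n) k i) =>
    fun p : ↥(↑S : Set (PS k n)) => eval (↑p : PS k n).rep (↑f : MvPolynomial (Fin n) k))

end EL

namespace EL

variable {k : Type} [Field k] {n : ℕ}

lemma eval_smul_of_isHomogeneous {f : MvPolynomial (Fin n) k} {d : ℕ} (hf : f.IsHomogeneous d)
    (t : k) (v : Fin n → k) : eval (t • v) f = t ^ d * eval v f := by
  rw [eval_eq', eval_eq', Finset.mul_sum]
  refine Finset.sum_congr rfl fun s hs => ?_
  have h := hf (mem_support_iff.mp hs)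
  rw [← h]
  simp only [Pi.smul_apply, smul_eq_mul, mul_pow, Finset.prod_mul_distrib,
    Finset.prod_pow_eq_pow_sum, Finsupp.weight_apply, Pi.one_apply, mul_one]
  rw [Finsupp.sum_fintype _ _ (by simp)]
  ring

lemma mk_mem_V0 {f : MvPolynomial (Fin n) k} {d : ℕ} (hf : f.IsHomogeneous d)
    {v : Fin n → k} (hv : v ≠ 0) : Projectivization.mk k v hv ∈ V0 f ↔ eval v f = 0 := by
  refine ⟨fun h => h v hv rfl, fun h w hw e => ?_⟩
  obtain ⟨a, rfl⟩ := (Projectivization.mk_eq_mk_iff' k w v hw hv).1 e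
  rw [eval_smul_of_isHomogeneous hf, h, mul_zero]

lemma mem_V0_iff_rep {f : MvPolynomial (Fin n) k} {d : ℕ} (hf : f.IsHomogeneous d)
    {p : PS k n} : p ∈ V0 f ↔ eval p.rep f = 0 := by
  conv_lhs => rw [← p.mk_rep]
  exact mk_mem_V0 hf p.rep_nonzero

lemma isClosed_V0 {f : MvPolynomial (Fin n) k} {d : ℕ} (hf : f.IsHomogeneous d) :
    IsClosed (V0 f) :=
  ⟨TopologicalSpace.isOpen_generateFrom_of_mem ⟨d, f, hf, rfl⟩⟩

lemma isTopologicalBasis_compl_V0 : TopologicalSpace.IsTopologicalBasis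
    {U : Set (PS k n) | ∃ (d : ℕ) (f : MvPolynomial (Fin n) k),
      f.IsHomogeneous d ∧ U = (V0 f)ᶜ} := by
  have h := TopologicalSpace.isTopologicalBasis_of_subbasis_of_inter (α := PS k n)
    (r := {U : Set (PS k n) | ∃ (d : ℕ) (f : MvPolynomial (Fin n) k),
      f.IsHomogeneous d ∧ U = (V0 f)ᶜ}) rfl ?_
  · rwa [Set.insert_eq_of_mem] at h
    refine ⟨0, 1, isHomogeneous_one _ _, ?_⟩
    ext p
    simp [mem_V0_iff_rep (isHomogeneous_one _ _)]
  · rintro _ ⟨d, f, hf, rfl⟩ _ ⟨e, g, hg, rfl⟩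
    refine ⟨d + e, f * g, hf.mul hg, ?_⟩
    ext p
    simp [mem_V0_iff_rep (hf.mul hg), mem_V0_iff_rep hf, mem_V0_iff_rep hg]

lemma exists_V0_of_isClosed {S : Set (PS k n)} (hS : IsClosed S) {p : PS k n} (hp : p ∉ S) :
    ∃ (d : ℕ) (f : MvPolynomial (Fin n) k), f.IsHomogeneous d ∧ S ⊆ V0 f ∧ p ∉ V0 f := by
  obtain ⟨_, ⟨d, f, hf, rfl⟩, h1, h2⟩ :=
    isTopologicalBasis_compl_V0.exists_subset_of_mem_open (show p ∈ Sᶜ from hp) hS.isOpen_compl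
  exact ⟨d, f, hf, Set.compl_subset_compl.1 h2, h1⟩

/-- The affine cone over a set of projective points, with the origin adjoined. -/
def cone (S : Set (PS k n)) : Set (Fin n → k) :=
  {v | ∀ hv : v ≠ 0, Projectivization.mk k v hv ∈ S}

lemma zero_mem_cone (S : Set (PS k n)) : (0 : Fin n → k) ∈ cone S := fun h => absurd rfl h

lemma rep_mem_cone {S : Set (PS k n)} {p : PS k n} : p.rep ∈ cone S ↔ p ∈ S :=
  ⟨fun h => by simpa using h p.rep_nonzero, fun h _ => by simpa using h⟩

lemma smul_mem_cone {S : Set (PS k n)} (t : k) {v : Fin n → k} (hv : v ∈ cone S) :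
    t • v ∈ cone S := by
  intro h
  have hv0 : v ≠ 0 := fun e => h (by simp [e])
  convert hv hv0 using 1
  rw [Projectivization.mk_eq_mk_iff']
  exact ⟨t, rfl⟩

lemma cone_mono {S T : Set (PS k n)} (h : S ⊆ T) : cone S ⊆ cone T := fun _ hv h0 => h (hv h0)

/-- The ideal of polynomials vanishing on the affine cone over `S`. -/
def coneIdeal (S : Set (PS k n)) : Ideal (MvPolynomial (Fin n) k) :=
  vanishingIdeal k (cone S)

lemma mem_coneIdeal {S : Set (PS k n)} {f : MvPolynomial (Fin n) k} :
    f ∈ coneIdeal S ↔ ∀ v ∈ cone S, eval v f = 0 := by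
  simp [coneIdeal, mem_vanishingIdeal_iff]

lemma coneIdeal_anti {S T : Set (PS k n)} (h : S ⊆ T) : coneIdeal T ≤ coneIdeal S :=
  vanishingIdeal_anti_mono (cone_mono h)

lemma eval_homogeneousComponent_eq_zero [Infinite k] {f : MvPolynomial (Fin n) k}
    {v : Fin n → k} (h : ∀ t : k, eval (t • v) f = 0) (d : ℕ) :
    eval v (homogeneousComponent d f) = 0 := by
  set P : Polynomial k := ∑ i ∈ Finset.range (f.totalDegree + 1),
    Polynomial.C (eval v (homogeneousComponent i f)) * Polynomial.X ^ i with hP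
  have hP0 : P = 0 := by
    refine Polynomial.funext fun t => ?_
    rw [Polynomial.eval_zero, ← h t]
    conv_rhs => rw [← sum_homogeneousComponent f]
    rw [hP, Polynomial.eval_finsetSum, map_sum]
    refine Finset.sum_congr rfl fun i _ => ?_
    rw [eval_smul_of_isHomogeneous (homogeneousComponent_isHomogeneous i f)]
    rw [Polynomial.eval_mul, Polynomial.eval_C, Polynomial.eval_pow, Polynomial.eval_X, mul_comm]
  by_cases hd : d ∈ Finset.range (f.totalDegree + 1)
  · have h1 : P.coeff d = 0 := by rw [hP0, Polynomial.coeff_zero]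
    rw [hP, Polynomial.finsetSum_coeff] at h1
    simp_rw [Polynomial.coeff_C_mul_X_pow] at h1
    rwa [Finset.sum_ite_eq, if_pos hd] at h1
  · rw [homogeneousComponent_eq_zero _ _ (by simpa using hd), map_zero]

lemma homogeneousComponent_mem_coneIdeal [Infinite k] {S : Set (PS k n)}
    {f : MvPolynomial (Fin n) k} (hf : f ∈ coneIdeal S) (d : ℕ) :
    homogeneousComponent d f ∈ coneIdeal S :=
  mem_coneIdeal.2 fun _ hv => eval_homogeneousComponent_eq_zero
    (fun t => mem_coneIdeal.1 hf _ (smul_mem_cone t hv)) d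

lemma mem_coneIdeal_iff_of_isHomogeneous {S : Set (PS k n)} (hS : S.Nonempty)
    {f : MvPolynomial (Fin n) k} {d : ℕ} (hf : f.IsHomogeneous d) :
    f ∈ coneIdeal S ↔ S ⊆ V0 f := by
  rw [mem_coneIdeal]
  refine ⟨fun h p hp => (mem_V0_iff_rep hf).2 (h _ (rep_mem_cone.2 hp)), fun h v hv => ?_⟩
  by_cases hv0 : v = 0
  · obtain ⟨p, hp⟩ := hS
    have h1 := (mem_V0_iff_rep hf).1 (h hp)
    have h2 := eval_smul_of_isHomogeneous hf 0 p.rep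
    rw [h1, mul_zero, zero_smul] at h2
    rwa [hv0]
  · exact (mk_mem_V0 hf hv0).1 (h (hv hv0))

lemma subset_V0_of_mem_coneIdeal {S : Set (PS k n)} {f : MvPolynomial (Fin n) k}
    (hf : f ∈ coneIdeal S) : S ⊆ V0 f := by
  rintro p hp v hv rfl
  exact mem_coneIdeal.1 hf v fun _ => hp

lemma coneIdeal_ne_top (S : Set (PS k n)) : coneIdeal S ≠ ⊤ := by
  rw [Ideal.ne_top_iff_one, mem_coneIdeal]
  intro h
  simpa using h 0 (zero_mem_cone S)

lemma zeroLocus_coneIdeal {S : Set (PS k n)} (hS : IsClosed S) (hne : S.Nonempty) :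
    zeroLocus k (coneIdeal S) = cone S := by
  refine Set.Subset.antisymm (fun v hv hv0 => ?_) (zeroLocus_vanishingIdeal_le _)
  by_contra hn
  obtain ⟨d, f, hf, h1, h2⟩ := exists_V0_of_isClosed hS hn
  refine h2 ((mk_mem_V0 hf hv0).2 ?_)
  simpa [coe_aeval_eq_eval] using hv f ((mem_coneIdeal_iff_of_isHomogeneous hne hf).2 h1)

lemma subset_of_coneIdeal_le {S T : Set (PS k n)} (hS : IsClosed S) (hne : S.Nonempty)
    (h : coneIdeal S ≤ coneIdeal T) : T ⊆ S := by
  intro p hp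
  have : p.rep ∈ zeroLocus k (coneIdeal S) := fun f hf => by
    simpa [coe_aeval_eq_eval] using mem_coneIdeal.1 (h hf) _ (rep_mem_cone.2 hp)
  rw [zeroLocus_coneIdeal hS hne] at this
  exact rep_mem_cone.1 this

lemma coneIdeal_isPrime [Infinite k] {S : Set (PS k n)} (hS : IsIrreducible S) :
    (coneIdeal S).IsPrime := by
  let : GradedAlgebra (homogeneousSubmodule (Fin n) k) := MvPolynomial.gradedAlgebra
  have hI : (coneIdeal S).IsHomogeneous (homogeneousSubmodule (Fin n) k) := by
    intro i f hf
    have := homogeneousComponent_mem_coneIdeal hf i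
    rwa [← decomposition.decompose'_apply] at this
  refine hI.isPrime_of_homogeneous_mem_or_mem (coneIdeal_ne_top S) ?_
  rintro f g ⟨d, hf⟩ ⟨e, hg⟩ hfg
  have hf : f.IsHomogeneous d := hf
  have hg : g.IsHomogeneous e := hg
  rw [mem_coneIdeal_iff_of_isHomogeneous hS.1 (hf.mul hg)] at hfg
  rw [mem_coneIdeal_iff_of_isHomogeneous hS.1 hf, mem_coneIdeal_iff_of_isHomogeneous hS.1 hg]
  refine isPreirreducible_iff_isClosed_union_isClosed.1 hS.2 _ _ (isClosed_V0 hf) (isClosed_V0 hg)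
    fun p hp => ?_
  have := (mem_V0_iff_rep (hf.mul hg)).1 (hfg hp)
  rw [map_mul, mul_eq_zero] at this
  exact this.imp (mem_V0_iff_rep hf).2 (mem_V0_iff_rep hg).2

instance : TopologicalSpace.NoetherianSpace (PS k n) := by
  have h := (TopologicalSpace.noetherianSpace_TFAE (PS k n)).out 0 1
  refine h.2 ?_
  refine StrictAnti.wellFoundedLT (β := Ideal (MvPolynomial (Fin n) k) )
    (f := fun S => if (S : Set (PS k n)) = ∅ then ⊤ else coneIdeal (S : Set (PS k n))) ?_
  intro S T hST
  have hT : (T : Set (PS k n)).Nonempty :=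
    (Set.nonempty_of_ssubset (s := (S : Set (PS k n))) hST).mono Set.sdiff_subset
  simp only [hT.ne_empty, if_false]
  split_ifs with h
  · exact lt_top_iff_ne_top.2 (coneIdeal_ne_top _)
  · refine lt_of_le_not_ge (coneIdeal_anti hST.le) fun hle => ?_
    exact not_le_of_gt hST (subset_of_coneIdeal_le S.isClosed (Set.nonempty_iff_ne_empty.2 h) hle)

lemma coneIdeal_univ [Infinite k] : coneIdeal (Set.univ : Set (PS k n)) = ⊥ := by
  refine (Submodule.eq_bot_iff _).2 fun f hf => MvPolynomial.funext fun v => ?_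
  rw [mem_coneIdeal.1 hf v fun _ => trivial, map_zero]

instance [Infinite k] : PreirreducibleSpace (PS k n) := by
  constructor
  rw [isPreirreducible_iff_isClosed_union_isClosed]
  intro A B hA hB hAB
  by_contra! h
  obtain ⟨⟨p, -, hp⟩, ⟨q, -, hq⟩⟩ := And.intro (Set.not_subset.1 h.1) (Set.not_subset.1 h.2)
  obtain ⟨d, f, hf, h1, h2⟩ := exists_V0_of_isClosed hA hp
  obtain ⟨e, g, hg, h3, h4⟩ := exists_V0_of_isClosed hB hq
  have hne : (Set.univ : Set (PS k n)).Nonempty := ⟨p, trivial⟩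
  have h5 : f * g ∈ coneIdeal (Set.univ : Set (PS k n)) := by
    rw [mem_coneIdeal_iff_of_isHomogeneous hne (hf.mul hg)]
    intro x hx
    rw [mem_V0_iff_rep (hf.mul hg), map_mul, mul_eq_zero]
    exact (hAB hx).imp (fun h => (mem_V0_iff_rep hf).1 (h1 h))
      fun h => (mem_V0_iff_rep hg).1 (h3 h)
  rw [coneIdeal_univ, Ideal.mem_bot, mul_eq_zero] at h5
  rcases h5 with rfl | rfl
  · exact h2 ((mem_V0_iff_rep hf).2 (by simp))
  · exact h4 ((mem_V0_iff_rep hg).2 (by simp))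

open TopologicalSpace in
lemma add_one_le_topologicalKrullDim {Y : Type*} [TopologicalSpace Y] {S T : Set Y} {d : ℕ}
    (hS : IsClosed S) (hST : S ⊆ T)
    (h : ∀ Z : Set Y, IsClosed Z → IsIrreducible Z → Z ⊆ S →
      ∃ W, IsClosed W ∧ IsIrreducible W ∧ W ⊆ T ∧ Z ⊂ W)
    (hd : (d : WithBot ℕ∞) ≤ topologicalKrullDim S) :
    ((d + 1 : ℕ) : WithBot ℕ∞) ≤ topologicalKrullDim T := by
  obtain ⟨l, hl⟩ := Order.le_krullDim_iff.1 hd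
  have hi : Topology.IsInducing (Set.inclusion hST) := 
    Topology.IsInducing.of_comp (continuous_inclusion hST) continuous_subtype_val .subtypeVal
  have hZ : IsClosed (Subtype.val '' (l.last : Set S)) := by
    exact hS.isClosedMap_subtype_val _ l.last.isClosed
  obtain ⟨W, hWc, hWi, hWT, hZW⟩ := h _ hZ
    (l.last.isIrreducible.image _ continuous_subtype_val.continuousOn)
    (by rintro _ ⟨x, -, rfl⟩; exact x.2)
  let W' : IrreducibleCloseds T :=
    { carrier := Subtype.val ⁻¹' W
      isIrreducible' := by
        refine ⟨?_, ?_⟩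
        · obtain ⟨x, hx⟩ := hWi.1
          exact ⟨⟨x, hWT hx⟩, hx⟩
        · rintro _ _ ⟨u, hu, rfl⟩ ⟨v, hv, rfl⟩ ⟨a, ha, ha'⟩ ⟨b, hb, hb'⟩
          obtain ⟨c, hc, hc'⟩ := hWi.2 u v hu hv ⟨a, ha, ha'⟩ ⟨b, hb, hb'⟩
          exact ⟨⟨c, hWT hc⟩, hc, hc'⟩
      isClosed' := hWc.preimage continuous_subtype_val }
  refine Order.le_krullDim_iff.2 ⟨(l.map _ (IrreducibleCloseds.map_strictMono_of_isInducing hi)).snoc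
    W' ?_, congrArg (· + 1) hl⟩
  rw [LTSeries.last_map]
  change (_ : IrreducibleCloseds T) < _
  refine SetLike.lt_iff_le_and_exists.2 ⟨?_, ?_⟩
  · refine closure_minimal ?_ W'.isClosed
    rintro _ ⟨x, hx, rfl⟩
    exact hZW.1 ⟨x, hx, rfl⟩
  · obtain ⟨x, hxW, hx⟩ := Set.exists_of_ssubset hZW
    refine ⟨⟨x, hWT hxW⟩, hxW, fun hc => hx ?_⟩
    have hsub : closure (Set.inclusion hST '' (l.last : Set S)) ⊆
        Subtype.val ⁻¹' (Subtype.val '' (l.last : Set S)) := by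
      refine closure_minimal ?_ (hZ.preimage continuous_subtype_val)
      rintro _ ⟨x, hx, rfl⟩
      exact ⟨x, hx, rfl⟩
    exact hsub hc

lemma pdim_lt_of_ssubset {S T : Set (PS k n)} {d : ℕ} (hS : IsClosed S) (hT : IsClosed T)
    (hTi : IsIrreducible T) (hST : S ⊂ T) (hd : (d : WithBot ℕ∞) ≤ pdim S) :
    ((d + 1 : ℕ) : WithBot ℕ∞) ≤ pdim T :=
  add_one_le_topologicalKrullDim hS hST.1
    (fun _ _ _ hZS => ⟨T, hT, hTi, subset_rfl, hZS.trans_ssubset hST⟩) hd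

open TopologicalSpace in
lemma add_one_le_of_le_pdim_univ [Infinite k] {d : ℕ}
    (hd : (d : WithBot ℕ∞) ≤ pdim (Set.univ : Set (PS k n))) : d + 1 ≤ n := by
  let F : WithBot (IrreducibleCloseds (PS k n)) → (PrimeSpectrum (MvPolynomial (Fin n) k))ᵒᵈ :=
    fun Z => OrderDual.toDual (WithBot.recBotCoe ⟨vanishingIdeal k {(0 : Fin n → k)}, inferInstance⟩
      (fun Z => ⟨coneIdeal (Z : Set (PS k n)), coneIdeal_isPrime Z.isIrreducible⟩) Z)
  have hF : StrictMono F := by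
    intro Z W hZW
    induction W with
    | bot => exact absurd hZW not_lt_bot
    | coe W =>
      obtain ⟨p, hp⟩ := W.isIrreducible.1
      induction Z with
      | bot =>
        change coneIdeal (W : Set (PS k n)) < vanishingIdeal k {(0 : Fin n → k)}
        refine lt_of_le_not_ge (vanishingIdeal_anti_mono (by
          rw [Set.singleton_subset_iff]; exact zero_mem_cone _)) fun hle => ?_
        refine p.rep_nonzero (funext fun i => ?_)
        have h1 : (X i : MvPolynomial (Fin n) k) ∈ vanishingIdeal k {(0 : Fin n → k)} := by
          simp [mem_vanishingIdeal_iff]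
        simpa using mem_coneIdeal.1 (hle h1) _ (rep_mem_cone.2 hp)
      | coe Z =>
        have hZW : Z < W := WithBot.coe_lt_coe.1 hZW
        change coneIdeal (W : Set (PS k n)) < coneIdeal (Z : Set (PS k n))
        refine lt_of_le_not_ge (coneIdeal_anti hZW.le) fun hle => ?_
        exact not_le_of_gt hZW (subset_of_coneIdeal_le Z.isClosed Z.isIrreducible.1 hle)
  have h0 : Nonempty (IrreducibleCloseds (PS k n)) := by
    by_contra hne
    rw [not_nonempty_iff] at hne
    have h1 : (d : WithBot ℕ∞) ≤ topologicalKrullDim (PS k n) :=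
      hd.trans (topologicalKrullDim_subspace_le _ _)
    obtain ⟨l, -⟩ := Order.le_krullDim_iff.1 h1
    exact hne.elim l.head
  have h1 := Order.krullDim_le_of_strictMono F hF
  rw [Order.krullDim_withBot, Order.krullDim_orderDual] at h1
  have h2 : Order.krullDim (PrimeSpectrum (MvPolynomial (Fin n) k)) = (n : WithBot ℕ∞) := by
    have := MvPolynomial.ringKrullDim_of_isNoetherianRing (R := k) (ι := Fin n)
    rw [ringKrullDim_eq_zero_of_field] at this
    simpa [ringKrullDim] using this
  have h3 : (d : WithBot ℕ∞) ≤ Order.krullDim (IrreducibleCloseds (PS k n)) :=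
    hd.trans (topologicalKrullDim_subspace_le _ _)
  have h4 : ((d + 1 : ℕ) : WithBot ℕ∞) ≤ n := by
    rw [← h2]
    push_cast
    exact (add_le_add_left h3 1).trans h1
  exact_mod_cast h4

open TopologicalSpace in
/-- A closed set of dimension less than `d` is avoided by the common zeros of `d` linear forms. -/
lemma exists_linear_forms [Infinite k] (d : ℕ) (S : Set (PS k n)) (hS : IsClosed S)
    (hd : ¬ (d : WithBot ℕ∞) ≤ pdim S) :
    ∃ z : Fin d → MvPolynomial (Fin n) k, (∀ i, (z i).IsHomogeneous 1) ∧
      ∀ p ∈ S, ∃ i, p ∉ V0 (z i) := by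
  induction d generalizing S with
  | zero =>
    refine ⟨Fin.elim0, fun i => i.elim0, fun p hp => absurd ?_ hd⟩
    have : Nonempty S := ⟨⟨p, hp⟩⟩
    have : Nonempty (IrreducibleCloseds S) :=
      ⟨⟨closure {⟨p, hp⟩}, isIrreducible_singleton.closure, isClosed_closure⟩⟩
    exact Order.krullDim_nonneg
  | succ d ih =>
    obtain ⟨C, hCf, hCc, hCi, rfl⟩ := NoetherianSpace.exists_finite_set_isClosed_irreducible hS
    have : Finite C := hCf
    choose p hp using fun c : C => (hCi c c.2).1
    obtain ⟨φ, hφ⟩ := Module.exists_dual_forall_apply_ne_zero (K := k)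
      (fun c : C => (p c).rep) fun c => (p c).rep_nonzero
    let z0 : MvPolynomial (Fin n) k := ∑ i, MvPolynomial.C (φ (Pi.single i 1)) * X i
    have hz0 : z0.IsHomogeneous 1 := IsHomogeneous.sum _ _ _ fun i _ => isHomogeneous_C_mul_X _ _
    have hz0e : ∀ v, eval v z0 = φ v := fun v => by
      conv_rhs => rw [pi_eq_sum_univ' v, map_sum]
      simp [z0, mul_comm]
    have hz0p : ∀ c, p c ∉ V0 z0 := fun c => by
      rw [mem_V0_iff_rep hz0, hz0e]; exact hφ c
    obtain ⟨z, hz, hzS⟩ := ih (⋃₀ C ∩ V0 z0) (hS.inter (isClosed_V0 hz0)) fun hle => by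
      refine hd (add_one_le_topologicalKrullDim (hS.inter (isClosed_V0 hz0))
        Set.inter_subset_left (fun Z hZc hZi hZ => ?_) hle)
      obtain ⟨W, hW, hZW⟩ := isIrreducible_iff_sUnion_isClosed.1 hZi hCf.toFinset
        (fun W hW => hCc W (hCf.mem_toFinset.1 hW))
        (by simpa using hZ.trans Set.inter_subset_left)
      rw [hCf.mem_toFinset] at hW
      refine ⟨W, hCc W hW, hCi W hW, Set.subset_sUnion_of_mem hW, hZW, fun hWZ => ?_⟩
      exact hz0p ⟨W, hW⟩ (hZ (hWZ (hp ⟨W, hW⟩))).2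
    refine ⟨Fin.cons z0 z, fun i => ?_, fun q hq => ?_⟩
    · refine Fin.cases hz0 hz i
    · by_cases h : q ∈ V0 z0
      · obtain ⟨i, hi⟩ := hzS q ⟨hq, h⟩
        exact ⟨i.succ, by simpa using hi⟩
      · exact ⟨0, by simpa using h⟩

lemma exists_linear_form {m : ℕ} (φ : (Fin m → k) →ₗ[k] k) :
    ∃ g : MvPolynomial (Fin m) k, g.IsHomogeneous 1 ∧ ∀ v, eval v g = φ v := by
  refine ⟨∑ i, MvPolynomial.C (φ (Pi.single i 1)) * X i,
    IsHomogeneous.sum _ _ _ fun i _ => isHomogeneous_C_mul_X _ _, fun v => ?_⟩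
  conv_rhs => rw [pi_eq_sum_univ' v, map_sum]
  simp [mul_comm]

lemma exists_pullback {m : ℕ} (φ : (Fin m → k) →ₗ[k] (Fin n → k)) {f : MvPolynomial (Fin n) k}
    {d : ℕ} (hf : f.IsHomogeneous d) :
    ∃ g : MvPolynomial (Fin m) k, g.IsHomogeneous d ∧ ∀ v, eval v g = eval (φ v) f := by
  choose g hg hge using fun i => exists_linear_form ((LinearMap.proj i).comp φ)
  refine ⟨aeval g f, by simpa using hf.aeval g hg, fun v => ?_⟩
  have h : φ v = fun i => eval v (g i) := funext fun i => (hge i v).symm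
  rw [h, ← coe_aeval_eq_eval, ← coe_aeval_eq_eval]
  change ((aeval v).comp (aeval g)) f = _
  rw [comp_aeval]
  rfl

lemma isInducing_map {m : ℕ} (φ : (Fin m → k) →ₗ[k] (Fin n → k)) (hφ : Function.Injective φ) :
    Topology.IsInducing (Projectivization.map φ hφ : PS k m → PS k n) := by
  have key : ∀ (d : ℕ) (f : MvPolynomial (Fin n) k) (g : MvPolynomial (Fin m) k),
      f.IsHomogeneous d → g.IsHomogeneous d → (∀ v, eval v g = eval (φ v) f) →
      Projectivization.map φ hφ ⁻¹' (V0 f)ᶜ = (V0 g)ᶜ := by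
    intro d f g hf hg h
    ext p
    induction p using Projectivization.ind with | h v hv =>
    simp only [Set.mem_preimage, Set.mem_compl_iff, Projectivization.map_mk, mk_mem_V0 hf,
      mk_mem_V0 hg, h]
  refine ⟨le_antisymm (continuous_iff_le_induced.1 (continuous_generateFrom_iff.2 ?_))
    (le_generateFrom ?_)⟩
  · rintro _ ⟨d, f, hf, rfl⟩
    obtain ⟨g, hg, h⟩ := exists_pullback φ hf
    rw [key d f g hf hg h]
    exact (isClosed_V0 hg).isOpen_compl
  · rintro _ ⟨d, g, hg, rfl⟩
    obtain ⟨ψ, hψ⟩ := φ.exists_leftInverse_of_injective (LinearMap.ker_eq_bot.2 hφ)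
    obtain ⟨f, hf, h⟩ := exists_pullback ψ hg
    refine ⟨(V0 f)ᶜ, (isClosed_V0 hf).isOpen_compl, key d f g hf hg fun v => ?_⟩
    rw [h, ← LinearMap.comp_apply, hψ, LinearMap.id_apply]

lemma isEmbedding_map {m : ℕ} (φ : (Fin m → k) →ₗ[k] (Fin n → k)) (hφ : Function.Injective φ) :
    Topology.IsEmbedding (Projectivization.map φ hφ : PS k m → PS k n) :=
  ⟨isInducing_map φ hφ, Projectivization.map_injective φ hφ⟩

lemma submodule_map {m : ℕ} (φ : (Fin m → k) →ₗ[k] (Fin n → k)) (hφ : Function.Injective φ)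
    (p : PS k m) : (Projectivization.map φ hφ p).submodule = p.submodule.map φ := by
  induction p using Projectivization.ind with | h v hv =>
  rw [Projectivization.map_mk, Projectivization.submodule_mk, Projectivization.submodule_mk,
    Submodule.map_span, Set.image_singleton]

lemma range_map {m : ℕ} (φ : (Fin m → k) →ₗ[k] (Fin n → k)) (hφ : Function.Injective φ) :
    Set.range (Projectivization.map φ hφ : PS k m → PS k n) = linSet (LinearMap.range φ) := by
  ext p
  induction p using Projectivization.ind with | h v hv =>
  simp only [linSet, Set.mem_ofPred_eq, Projectivization.submodule_mk,
    Submodule.span_singleton_le_iff_mem]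
  constructor
  · rintro ⟨q, hq⟩
    have h := submodule_map φ hφ q
    rw [hq, Projectivization.submodule_mk] at h
    have : v ∈ q.submodule.map φ := h ▸ Submodule.mem_span_singleton_self v
    exact LinearMap.map_le_range this
  · rintro ⟨w, rfl⟩
    exact ⟨Projectivization.mk k w fun h => hv (by rw [h, map_zero]), Projectivization.map_mk ..⟩

lemma pspan_image {m : ℕ} (φ : (Fin m → k) →ₗ[k] (Fin n → k)) (hφ : Function.Injective φ)
    (S : Set (PS k m)) : pspan (Projectivization.map φ hφ '' S) = (pspan S).map φ := by
  simp only [pspan, iSup_image, Submodule.map_iSup, submodule_map]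

lemma isIrreducible_of_image {Y Z : Type*} [TopologicalSpace Y] [TopologicalSpace Z] {f : Y → Z}
    (hf : Topology.IsInducing f) {S : Set Y} (h : IsIrreducible (f '' S)) : IsIrreducible S := by
  refine ⟨h.1.of_image, fun u v hu hv ⟨a, ha, hau⟩ ⟨b, hb, hbv⟩ => ?_⟩
  obtain ⟨U, hU, rfl⟩ := hf.isOpen_iff.1 hu
  obtain ⟨V, hV, rfl⟩ := hf.isOpen_iff.1 hv
  obtain ⟨_, ⟨c, hc, rfl⟩, hc'⟩ := h.2 U V hU hV ⟨f a, ⟨a, ha, rfl⟩, hau⟩ ⟨f b, ⟨b, hb, rfl⟩, hbv⟩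
  exact ⟨c, hc, hc'⟩

lemma pdim_image {m : ℕ} (φ : (Fin m → k) →ₗ[k] (Fin n → k)) (hφ : Function.Injective φ)
    (S : Set (PS k m)) : pdim (Projectivization.map φ hφ '' S) = pdim S :=
  (((isEmbedding_map φ hφ).homeomorphImage S).isHomeomorph.topologicalKrullDim_eq).symm

lemma exists_parametrization (Λ : Submodule k (Fin n → k)) {m : ℕ} (hm : Module.finrank k Λ = m) :
    ∃ φ : (Fin m → k) →ₗ[k] (Fin n → k), Function.Injective φ ∧ LinearMap.range φ = Λ := by
  let e : (Fin m → k) ≃ₗ[k] Λ := LinearEquiv.ofFinrankEq _ _ (by simp [hm])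
  refine ⟨Λ.subtype ∘ₗ e.toLinearMap, Λ.injective_subtype.comp e.injective, ?_⟩
  rw [LinearMap.range_comp, LinearEquiv.range, Submodule.map_top, Submodule.range_subtype]

lemma map_incidence {m : ℕ} (φ : (Fin m → k) →ₗ[k] (Fin n → k)) (hφ : Function.Injective φ)
    {o a b : PS k m} : (Projectivization.map φ hφ o).submodule ≤
      (Projectivization.map φ hφ a).submodule ⊔ (Projectivization.map φ hφ b).submodule ↔
      o.submodule ≤ a.submodule ⊔ b.submodule := by
  simp only [submodule_map, ← Submodule.map_sup]
  exact Submodule.map_le_map_iff_of_injective hφ _ _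

lemma eval_add_of_isHomogeneous_one {F : MvPolynomial (Fin n) k} (hF : F.IsHomogeneous 1)
    (v w : Fin n → k) : eval (v + w) F = eval v F + eval w F := by
  have h1 : ∀ i, ∃ c : k, pderiv i F = C c := fun i =>
    ⟨_, totalDegree_eq_zero_iff_eq_C.1 (Nat.le_zero.1 (hF.pderiv (i := i)).totalDegree_le)⟩
  choose c hc using h1
  have h2 := hF.sum_X_mul_pderiv
  rw [one_smul] at h2
  rw [← h2]
  simp [hc, add_mul, Finset.sum_add_distrib]

lemma eval_eq_zero_of_pspan_eq_top {S : Set (PS k n)} (hS : pspan S = ⊤)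
    {F : MvPolynomial (Fin n) k} (hF : F.IsHomogeneous 1) (h : S ⊆ V0 F) (v : Fin n → k) :
    eval v F = 0 := by
  let K : Submodule k (Fin n → k) :=
    { carrier := {v | eval v F = 0}
      add_mem' := fun {a b} ha hb => by
        change eval (a + b) F = 0
        rw [eval_add_of_isHomogeneous_one hF, show eval a F = 0 from ha, show eval b F = 0 from hb,
          add_zero]
      zero_mem' := by
        have := eval_smul_of_isHomogeneous hF 0 0
        simpa using this
      smul_mem' := fun c a ha => by
        change eval (c • a) F = 0
        rw [eval_smul_of_isHomogeneous hF, show eval a F = 0 from ha, mul_zero] }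
  have h1 : pspan S ≤ K := by
    refine iSup₂_le fun p hp => ?_
    rw [Projectivization.submodule_eq, Submodule.span_singleton_le_iff_mem]
    exact (mem_V0_iff_rep hF).1 (h hp)
  have h2 : v ∈ K := h1 (hS ▸ Submodule.mem_top)
  exact h2

lemma isIrreducible_of_coneIdeal_isPrime {S : Set (PS k n)} (hS : S.Nonempty)
    (h : (coneIdeal S).IsPrime) : IsIrreducible S := by
  refine ⟨hS, isPreirreducible_iff_isClosed_union_isClosed.2 fun A B hA hB hAB => ?_⟩
  by_contra! hn
  obtain ⟨⟨p, hpS, hp⟩, ⟨q, hqS, hq⟩⟩ := And.intro (Set.not_subset.1 hn.1) (Set.not_subset.1 hn.2)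
  obtain ⟨d, f, hf, h1, h2⟩ := exists_V0_of_isClosed hA hp
  obtain ⟨e, g, hg, h3, h4⟩ := exists_V0_of_isClosed hB hq
  have h5 : f * g ∈ coneIdeal S := by
    rw [mem_coneIdeal_iff_of_isHomogeneous hS (hf.mul hg)]
    intro x hx
    rw [mem_V0_iff_rep (hf.mul hg), map_mul, mul_eq_zero]
    exact (hAB hx).imp (fun h => (mem_V0_iff_rep hf).1 (h1 h))
      fun h => (mem_V0_iff_rep hg).1 (h3 h)
  rcases h.mem_or_mem h5 with h6 | h6
  · exact h2 (subset_V0_of_mem_coneIdeal h6 hpS)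
  · exact h4 (subset_V0_of_mem_coneIdeal h6 hqS)

lemma isIrreducible_V0 [IsAlgClosed k] {F : MvPolynomial (Fin n) k} {d : ℕ}
    (hF : F.IsHomogeneous d) (hp : Prime F) (hne : (V0 F).Nonempty) : IsIrreducible (V0 F) := by
  refine isIrreducible_of_coneIdeal_isPrime hne ?_
  have h1 : (Ideal.span {F}).IsPrime := (Ideal.span_singleton_prime hp.ne_zero).2 hp
  have h2 : coneIdeal (V0 F) = Ideal.span {F} := by
    refine le_antisymm (fun f hf => ?_) ?_
    · rw [← h1.radical, ← vanishingIdeal_zeroLocus_eq_radical (K := k), mem_vanishingIdeal_iff]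
      intro v hv
      change eval v f = 0
      refine mem_coneIdeal.1 hf v fun hv0 => (mk_mem_V0 hF hv0).2 ?_
      simpa [coe_aeval_eq_eval] using hv F (Ideal.mem_span_singleton_self F)
    · rw [Ideal.span_singleton_le_iff_mem, mem_coneIdeal_iff_of_isHomogeneous hne hF]
  rwa [h2]

lemma derivative_aeval (g : Fin n → Polynomial k) (F : MvPolynomial (Fin n) k) :
    Polynomial.derivative (aeval g F) =
      ∑ i, aeval g (pderiv i F) * Polynomial.derivative (g i) := by
  induction F using MvPolynomial.induction_on with
  | C a => simp [Polynomial.algebraMap_eq]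
  | add p q hp hq => simp [hp, hq, add_mul, Finset.sum_add_distrib]
  | mul_X p i hp =>
    have h : ∀ j, aeval g (pderiv j (p * X i)) * Polynomial.derivative (g j) =
        aeval g (pderiv j p) * Polynomial.derivative (g j) * g i +
          if j = i then aeval g p * Polynomial.derivative (g j) else 0 := by
      intro j
      rw [Derivation.leibniz]
      split_ifs with hj
      · subst hj
        simp only [pderiv_X_self, smul_eq_mul, mul_one, map_add, map_mul, aeval_X]
        ring
      · simp only [pderiv_X_of_ne (Ne.symm hj), smul_eq_mul, mul_zero, map_add, map_mul, aeval_X,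
          map_zero]
        ring
    rw [Finset.sum_congr rfl fun j _ => h j, Finset.sum_add_distrib, ← Finset.sum_mul, ← hp,
      Finset.sum_ite_eq' Finset.univ i, if_pos (Finset.mem_univ i), map_mul, aeval_X,
      Polynomial.derivative_mul]

lemma polynomial_eval_aeval (g : Fin n → Polynomial k) (G : MvPolynomial (Fin n) k) (t : k) :
    (aeval g G).eval t = eval (fun i => (g i).eval t) G := by
  rw [← coe_aeval_eq_eval]
  change (Polynomial.evalRingHom t) (aeval g G) = _
  rw [← Polynomial.coe_aeval_eq_evalRingHom]
  change ((Polynomial.aeval t).comp (aeval g)) G = _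
  rw [comp_aeval]
  rfl

lemma exists_root_on_line [IsAlgClosed k] {F : MvPolynomial (Fin n) k} {d : ℕ}
    (hF : F.IsHomogeneous d) (hd : 2 ≤ d) {a o : Fin n → k} (ha : eval a F = 0)
    (hD : ∑ i, o i * eval a (pderiv i F) ≠ 0) : ∃ s : k, eval (s • a + o) F = 0 := by
  let P : Polynomial k := aeval (fun i => Polynomial.C (a i) + Polynomial.C (o i) *
    Polynomial.X) F
  let Q : Polynomial k := aeval (fun i => Polynomial.C (a i) * Polynomial.X +
    Polynomial.C (o i)) F
  have hP : ∀ t, P.eval t = eval (a + t • o) F := fun t => by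
    simp only [P, polynomial_eval_aeval, Polynomial.eval_add, Polynomial.eval_mul,
      Polynomial.eval_C, Polynomial.eval_X, mul_comm _ t]
    rfl
  have hQ : ∀ t, Q.eval t = eval (t • a + o) F := fun t => by
    simp only [Q, polynomial_eval_aeval, Polynomial.eval_add, Polynomial.eval_mul,
      Polynomial.eval_C, Polynomial.eval_X, mul_comm _ t]
    rfl
  have hQd : Q.degree ≠ 0 := by
    intro hdeg
    have hQC := Polynomial.eq_C_of_degree_eq_zero hdeg
    generalize Q.coeff 0 = c at hQC
    have hPc : P = Polynomial.C c * Polynomial.X ^ d := by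
      refine Polynomial.funext fun t => ?_
      by_cases ht : t = 0
      · rw [hP, ht, zero_smul, add_zero, ha]
        simp [show d ≠ 0 by omega]
      · have h1 : a + t • o = t • (t⁻¹ • a + o) := by
          rw [smul_add, smul_smul, mul_inv_cancel₀ ht, one_smul]
        rw [hP, h1, eval_smul_of_isHomogeneous hF, ← hQ, hQC, Polynomial.eval_C,
          Polynomial.eval_mul, Polynomial.eval_C, Polynomial.eval_pow, Polynomial.eval_X, mul_comm]
    have h2 : P.derivative.eval 0 = ∑ i, o i * eval a (pderiv i F) := by
      rw [derivative_aeval, Polynomial.eval_finsetSum]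
      refine Finset.sum_congr rfl fun i _ => ?_
      rw [Polynomial.eval_mul, polynomial_eval_aeval, mul_comm]
      simp
    rw [hPc] at h2
    refine hD (h2.symm.trans ?_)
    simp [Polynomial.derivative_X_pow, show d - 1 ≠ 0 by omega]
  obtain ⟨s, hs⟩ := IsAlgClosed.exists_root Q hQd
  exact ⟨s, by rw [← hQ]; exact hs⟩

/-- An irreducible closed set of codimension at most one is cut out by a form of minimal degree. -/
lemma exists_minimal_equation [IsAlgClosed k] {γ : ℕ} {Γ : Set (PS k (γ + 2))}
    (hc : IsClosed Γ) (hi : IsIrreducible Γ) (hd : (γ : WithBot ℕ∞) ≤ pdim Γ)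
    (hne : Γ ≠ Set.univ) :
    ∃ (d : ℕ) (F : MvPolynomial (Fin (γ + 2)) k), F.IsHomogeneous d ∧ Γ = V0 F ∧ F ≠ 0 ∧
      ∀ (e : ℕ) (G : MvPolynomial (Fin (γ + 2)) k), G.IsHomogeneous e → e < d →
        G ∈ coneIdeal Γ → G = 0 := by
  classical
  have hp := coneIdeal_isPrime hi
  have hex : ∃ d : ℕ, ∃ F : MvPolynomial (Fin (γ + 2)) k, F.IsHomogeneous d ∧ F ≠ 0 ∧
      F ∈ coneIdeal Γ := by
    obtain ⟨q, hq⟩ := (Set.ne_univ_iff_exists_notMem _).1 hne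
    obtain ⟨d, f, hf, h1, h2⟩ := exists_V0_of_isClosed hc hq
    refine ⟨d, f, hf, fun h0 => h2 ?_, (mem_coneIdeal_iff_of_isHomogeneous hi.1 hf).2 h1⟩
    rw [mem_V0_iff_rep hf, h0, map_zero]
  set d := Nat.find hex with hdd
  obtain ⟨F, hF, hF0, hFp⟩ := Nat.find_spec hex
  rw [← hdd] at hF
  have hmin : ∀ (e : ℕ) (G : MvPolynomial (Fin (γ + 2)) k), G.IsHomogeneous e → e < d →
        G ∈ coneIdeal Γ → G = 0 := fun e G hG he hGp => by
    by_contra h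
    exact Nat.find_min hex he ⟨G, hG, h, hGp⟩
  have hdeg : ∀ G ∈ coneIdeal Γ, G ≠ 0 → d ≤ G.totalDegree := fun G hG hG0 => by
    by_contra! hlt
    refine hG0 ?_
    rw [← sum_homogeneousComponent G]
    refine Finset.sum_eq_zero fun i hi => hmin i _ (homogeneousComponent_isHomogeneous i G) ?_
      (homogeneousComponent_mem_coneIdeal hG i)
    rw [Finset.mem_range] at hi
    omega
  have hunit : ∀ a b : MvPolynomial (Fin (γ + 2)) k, F = a * b → a ∈ coneIdeal Γ → IsUnit b := by
    intro a b hab ha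
    have ha0 : a ≠ 0 := by rintro rfl; exact hF0 (by simpa using hab)
    have hb0 : b ≠ 0 := by rintro rfl; exact hF0 (by simpa using hab)
    have h1 := hdeg a ha ha0
    have h2 := hF.totalDegree hF0
    rw [hab, totalDegree_mul_of_isDomain ha0 hb0] at h2
    have h3 : b.totalDegree = 0 := by omega
    rw [totalDegree_eq_zero_iff_eq_C] at h3
    rw [h3] at hb0 ⊢
    exact (IsUnit.mk0 _ fun h => hb0 (by rw [h, C_0])).map C
  have hirr : Irreducible F := by
    refine ⟨fun hu => coneIdeal_ne_top _ (Ideal.eq_top_of_isUnit_mem _ hFp hu), fun a b hab => ?_⟩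
    rcases hp.mem_or_mem (hab ▸ hFp : a * b ∈ coneIdeal Γ) with h | h
    · exact Or.inr (hunit a b hab h)
    · exact Or.inl (hunit b a (by rw [hab, mul_comm]) h)
  have hΓF : Γ ⊆ V0 F := subset_V0_of_mem_coneIdeal hFp
  have hFi := isIrreducible_V0 hF hirr.prime (hi.1.mono hΓF)
  refine ⟨d, F, hF, ?_, hF0, hmin⟩
  by_contra hneF
  have h1 := pdim_lt_of_ssubset hc (isClosed_V0 hF) hFi (hΓF.ssubset_of_ne hneF) hd
  have h2 : V0 F ≠ Set.univ := fun h => hF0 <| by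
    have := (mem_coneIdeal_iff_of_isHomogeneous (hi.1.mono hΓF) hF).2 subset_rfl
    rw [h, coneIdeal_univ] at this
    exact this
  have h3 := pdim_lt_of_ssubset (isClosed_V0 hF) isClosed_univ
    ⟨hi.1.mono (Set.subset_univ _), PreirreducibleSpace.isPreirreducible_univ⟩
    (Set.ssubset_univ_iff.2 h2) h1
  have := add_one_le_of_le_pdim_univ h3
  omega

lemma subset_closure_secant_points [IsAlgClosed k] [CharZero k] {γ : ℕ} {Γ : Set (PS k (γ + 2))}
    (hc : IsClosed Γ) (hi : IsIrreducible Γ) (hd : (γ : WithBot ℕ∞) ≤ pdim Γ)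
    (hsp : pspan Γ = ⊤) {o : PS k (γ + 2)} (ho : o ∉ Γ) :
    Γ ⊆ closure {a | a ∈ Γ ∧ ∃ b ∈ Γ, b ≠ a ∧ o.submodule ≤ a.submodule ⊔ b.submodule} := by
  obtain ⟨d, F, hF, hΓ, hF0, hmin⟩ := exists_minimal_equation hc hi hd
    (fun h => ho (h ▸ Set.mem_univ o))
  have hFo : eval o.rep F ≠ 0 := by rwa [hΓ, mem_V0_iff_rep hF] at ho
  have hd2 : 2 ≤ d := by
    by_contra! hlt
    obtain ⟨p, hp⟩ := hi.1
    rw [hΓ, mem_V0_iff_rep hF] at hp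
    interval_cases d
    · have h := totalDegree_eq_zero_iff_eq_C.1 (Nat.le_zero.1 hF.totalDegree_le)
      rw [h, eval_C] at hp hFo
      exact hFo hp
    · exact hFo (eval_eq_zero_of_pspan_eq_top hsp hF hΓ.subset _)
  let D : MvPolynomial (Fin (γ + 2)) k := ∑ i, C (o.rep i) * pderiv i F
  have hD : D.IsHomogeneous (d - 1) := IsHomogeneous.sum _ _ _ fun i _ => by
    simpa using (isHomogeneous_C _ (o.rep i)).mul (hF.pderiv (i := i))
  have hDo : eval o.rep D ≠ 0 := by
    have h := congrArg (eval o.rep) hF.sum_X_mul_pderiv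
    simp only [map_sum, map_mul, eval_X, nsmul_eq_mul, map_natCast] at h
    simp only [D, map_sum, map_mul, eval_C, h]
    exact mul_ne_zero (Nat.cast_ne_zero.2 (by omega)) hFo
  have hDp : D ∉ coneIdeal Γ := fun h => hDo <| by
    rw [hmin _ D hD (by omega) h, map_zero]
  rw [mem_coneIdeal_iff_of_isHomogeneous hi.1 hD, Set.not_subset] at hDp
  obtain ⟨a0, ha0, ha0D⟩ := hDp
  refine (subset_closure_inter_of_isPreirreducible_of_isOpen hi.2 (isClosed_V0 hD).isOpen_compl
    ⟨a0, ha0, ha0D⟩).trans (closure_mono ?_)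
  rintro a ⟨ha, haD⟩
  rw [Set.mem_compl_iff, mem_V0_iff_rep hD] at haD
  have hFa : eval a.rep F = 0 := by rwa [hΓ, mem_V0_iff_rep hF] at ha
  obtain ⟨s, hs⟩ := exists_root_on_line hF hd2 hFa (o := o.rep) (by simpa [D] using haD)
  have hoa : ∀ c : k, o.rep ≠ c • a.rep := fun c h => by
    rw [h, eval_smul_of_isHomogeneous hF, hFa, mul_zero] at hFo
    exact hFo rfl
  have hb0 : s • a.rep + o.rep ≠ 0 := fun h => hoa (-s) (by
    rw [neg_smul]; exact eq_neg_of_add_eq_zero_right h)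
  refine ⟨ha, Projectivization.mk k _ hb0, ?_, fun h => ?_, ?_⟩
  · rw [hΓ, mk_mem_V0 hF]; exact hs
  · obtain ⟨c, hc⟩ := (Projectivization.mk_eq_mk_iff' k _ _ hb0 a.rep_nonzero).1
      (h.trans a.mk_rep.symm)
    exact hoa (c - s) (by rw [sub_smul, hc]; abel)
  · rw [Projectivization.submodule_mk, a.submodule_eq, o.submodule_eq,
      Submodule.span_singleton_le_iff_mem, Submodule.mem_sup]
    exact ⟨(-s) • a.rep, Submodule.smul_mem _ _ (Submodule.mem_span_singleton_self _),
      s • a.rep + o.rep, Submodule.mem_span_singleton_self _, by rw [neg_smul]; abel⟩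

lemma homogeneousComponent_succ_mul {z : MvPolynomial (Fin n) k} (hz : z.IsHomogeneous 1)
    (g : MvPolynomial (Fin n) k) (t : ℕ) :
    homogeneousComponent (t + 1) (z * g) = z * homogeneousComponent t g := by
  conv_lhs => rw [← sum_homogeneousComponent g]
  rw [Finset.mul_sum, map_sum]
  have h (i : ℕ) : homogeneousComponent (t + 1) (z * homogeneousComponent i g) =
      if t = i then z * homogeneousComponent t g else 0 := by
    rw [homogeneousComponent_of_mem (n := i + 1)
      (by simpa [add_comm] using hz.mul (homogeneousComponent_isHomogeneous i g))]
    by_cases e : t = i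
    · subst e; simp
    · rw [if_neg e, if_neg (by omega)]
  rw [Finset.sum_congr rfl fun i _ => h i, Finset.sum_ite_eq]
  split_ifs with ht
  · rfl
  · rw [homogeneousComponent_eq_zero t g (by simpa using ht), mul_zero]

/-- If finitely many linear forms have no common zero on the projective set `S`, then the
homogeneous coordinate ring of `S` is integral over the subalgebra they generate. -/
lemma isIntegral_quotient_coneIdeal [IsAlgClosed k] {S : Set (PS k n)} (hS : IsClosed S)
    (hne : S.Nonempty) {d : ℕ} {z : Fin d → MvPolynomial (Fin n) k}
    (hz : ∀ i, (z i).IsHomogeneous 1) (hzS : ∀ p ∈ S, ∃ i, p ∉ V0 (z i)) :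
    Algebra.IsIntegral (Algebra.adjoin k (Set.range z))
      (MvPolynomial (Fin n) k ⧸ coneIdeal S) := by
  set T := Algebra.adjoin k (Set.range z)
  set J : Ideal (MvPolynomial (Fin n) k) := Ideal.span (Set.range z) ⊔ coneIdeal S
  have hJ : idealOfVars (Fin n) k ≤ J.radical := by
    rw [← vanishingIdeal_zeroLocus_eq_radical (K := k), idealOfVars, Ideal.span_le]
    rintro _ ⟨i, rfl⟩
    refine (mem_vanishingIdeal_iff).2 fun v hv => ?_
    have hv0 : v = 0 := by
      by_contra hv0
      have h1 : v ∈ cone S := by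
        rw [← zeroLocus_coneIdeal hS hne]
        exact fun f hf => hv f (Ideal.mem_sup_right hf)
      obtain ⟨j, hj⟩ := hzS _ (h1 hv0)
      refine hj ((mk_mem_V0 (hz j) hv0).2 ?_)
      exact hv _ (Ideal.mem_sup_left (Ideal.subset_span ⟨j, rfl⟩))
    simp [hv0]
  obtain ⟨N, hN⟩ := Ideal.exists_pow_le_of_le_radical_of_fg hJ (idealOfVars_fg _ _)
  set G : Set (MvPolynomial (Fin n) k) := (fun s => monomial s 1) '' {s | s.degree ≤ N} with hG
  have hGf : G.Finite := (Finsupp.finite_of_degree_le N).image _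
  set W : Submodule T (MvPolynomial (Fin n) k) :=
    Submodule.span T G ⊔ (coneIdeal S).restrictScalars T with hW
  have hzW {i f} (hf : f ∈ W) : z i * f ∈ W :=
    W.smul_mem (⟨z i, Algebra.subset_adjoin ⟨i, rfl⟩⟩ : T) hf
  have hCW (c : k) {f} (hf : f ∈ W) : c • f ∈ W := by
    have := W.smul_mem (algebraMap k T c) hf
    rwa [algebraMap_smul] at this
  have key : ∀ e (f : MvPolynomial (Fin n) k), f.IsHomogeneous e → f ∈ W := by
    intro e
    induction e with
    | zero =>
      intro f hf
      rw [← support_sum_monomial_coeff f]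
      refine sum_mem fun s hs => ?_
      rw [← mul_one (coeff s f), ← smul_eq_mul, ← smul_monomial]
      refine hCW _ (Submodule.mem_sup_left (Submodule.subset_span ⟨s, ?_, rfl⟩))
      have := hf.degree_eq_sum_deg_support hs
      simp only [Set.mem_ofPred_eq]
      rw [Finsupp.degree_apply, ← this]
      exact Nat.zero_le _
    | succ e ih =>
      intro f hf
      by_cases he : e + 1 < N
      · rw [← support_sum_monomial_coeff f]
        refine sum_mem fun s hs => ?_
        rw [← mul_one (coeff s f), ← smul_eq_mul, ← smul_monomial]
        refine hCW _ (Submodule.mem_sup_left (Submodule.subset_span ⟨s, ?_, rfl⟩))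
        have := hf.degree_eq_sum_deg_support hs
        simp only [Set.mem_ofPred_eq]
        rw [Finsupp.degree_apply, ← this]
        exact he.le
      · have h1 : f ∈ J := hN ((mem_pow_idealOfVars_iff' _ _).2 fun x hx =>
          hf.coeff_eq_zero (by omega))
        obtain ⟨a, ha, b, hb, rfl⟩ := Submodule.mem_sup.1 h1
        obtain ⟨c, rfl⟩ := (Ideal.mem_span_range_iff_exists_fun).1 ha
        have h2 := (homogeneousComponent_of_mem (m := e + 1) hf)
        rw [if_pos rfl, map_add, map_sum] at h2
        rw [← h2]
        refine add_mem (sum_mem fun i _ => ?_)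
          (Submodule.mem_sup_right (homogeneousComponent_mem_coneIdeal hb _))
        rw [mul_comm, homogeneousComponent_succ_mul (hz i)]
        exact hzW (ih _ (homogeneousComponent_isHomogeneous _ _))
  have hfin : Module.Finite T (MvPolynomial (Fin n) k ⧸ coneIdeal S) := by
    refine ⟨Submodule.fg_def.2 ⟨(Ideal.Quotient.mkₐ T (coneIdeal S)) '' G, hGf.image _, ?_⟩⟩
    refine eq_top_iff.2 fun x _ => ?_
    obtain ⟨f, rfl⟩ := Ideal.Quotient.mk_surjective x
    have hf : f ∈ W := by
      rw [← sum_homogeneousComponent f]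
      exact sum_mem fun i _ => key i _ (homogeneousComponent_isHomogeneous _ _)
    obtain ⟨a, ha, b, hb, rfl⟩ := Submodule.mem_sup.1 hf
    rw [map_add, (Ideal.Quotient.eq_zero_iff_mem (a := b)).2 hb, add_zero]
    have := Submodule.mem_map_of_mem (f := (Ideal.Quotient.mkₐ T (coneIdeal S)).toLinearMap) ha
    rw [Submodule.map_span] at this
    exact this
  exact Algebra.IsIntegral.of_finite T _

open scoped TensorProduct in
lemma le_of_algebraicIndependent {R A D : Type} [CommRing R] [CommRing A] [CommRing D] [IsDomain D]
    [Algebra k R] [Algebra k A] [Algebra R A] [IsScalarTower k R A] [Algebra k D] [Algebra A D]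
    [IsScalarTower k A D] [Nontrivial A] {d : ℕ} (z : Fin d → R)
    [Algebra.IsIntegral (Algebra.adjoin k (Set.range z)) A]
    {π : Polynomial (A ⊗[k] A) →ₐ[A] D} (hπ : Function.Surjective π) {m : ℕ} {y : Fin m → D}
    (hy : AlgebraicIndependent A y) : m ≤ d + 1 := by
  let r : A →ₐ[k] D := ((π.restrictScalars k).comp (Polynomial.CAlgHom (R := k))).comp
    (Algebra.TensorProduct.includeRight (R := k) (A := A) (B := A))
  let s : Fin (d + 1) → D := Fin.cons (π Polynomial.X) fun i => r (algebraMap R A (z i))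
  let B := Algebra.adjoin A (Set.range s)
  have hint (a : A) : IsIntegral B (r a) := by
    obtain ⟨p, hp, hpa⟩ := Algebra.IsIntegral.isIntegral
      (R := Algebra.adjoin k (Set.range z)) a
    let ψ : R →ₐ[k] D := r.comp (IsScalarTower.toAlgHom k R A)
    have hψ : Algebra.adjoin k (Set.range z) ≤ (B.restrictScalars k).comap ψ :=
      Algebra.adjoin_le (by
        rintro _ ⟨i, rfl⟩
        exact Algebra.subset_adjoin ⟨i.succ, rfl⟩)
    let θ : Algebra.adjoin k (Set.range z) →+* B :=
      { toFun := fun t => ⟨ψ t, hψ t.2⟩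
        map_one' := Subtype.ext (map_one ψ)
        map_mul' := fun a b => Subtype.ext (map_mul ψ _ _)
        map_zero' := Subtype.ext (map_zero ψ)
        map_add' := fun a b => Subtype.ext (map_add ψ _ _) }
    refine ⟨p.map θ, hp.map θ, ?_⟩
    rw [Polynomial.eval₂_map]
    have := congrArg r hpa
    rw [map_zero] at this
    rw [← this]
    exact (Polynomial.hom_eval₂ p (algebraMap _ A) r.toRingHom a).symm
  have hall (f : Polynomial (A ⊗[k] A)) : IsIntegral B (π f) := by
    have hC (a : A ⊗[k] A) : IsIntegral B (π (Polynomial.C a)) := by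
      induction a using TensorProduct.induction_on with
      | zero => simpa using isIntegral_zero
      | add a b ha hb => simpa using ha.add hb
      | tmul a b =>
        have h1 : π (Polynomial.C (a ⊗ₜ[k] b)) = algebraMap A D a * r b := by
          have : (a ⊗ₜ[k] b) = algebraMap A (A ⊗[k] A) a * (1 ⊗ₜ[k] b) := by
            simp [Algebra.TensorProduct.algebraMap_apply]
          rw [this, Polynomial.C_mul, map_mul]
          congr 1
          exact π.commutes a
        rw [h1]
        exact (isIntegral_algebraMap (R := B) (x := algebraMap A B a)).mul (hint b)
    have hX : IsIntegral B (π Polynomial.X) :=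
      isIntegral_algebraMap (R := B) (x := ⟨_, Algebra.subset_adjoin ⟨0, rfl⟩⟩)
    induction f using Polynomial.induction_on' with
    | add p q hp hq => simpa using hp.add hq
    | monomial e a =>
      rw [← Polynomial.C_mul_X_pow_eq_monomial, map_mul, map_pow]
      exact (hC a).mul (hX.pow e)
  have hBD : Algebra.IsIntegral B D := ⟨hπ.forall.2 hall⟩
  have h1 := hy.cardinalMk_le_trdeg
  have h2 := Algebra.IsAlgebraic.trdeg_le_cardinalMk A (Set.range s)
  have h3 := (h1.trans h2).trans Cardinal.mk_range_le
  simpa only [Cardinal.mk_fin, Nat.cast_le] using h3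

open scoped TensorProduct in
/-- More than `d + 1` elements `s x i ⊗ 1 + 1 ⊗ x i` of `(A ⊗ A)[s]` satisfy a polynomial relation
with coefficients in `A` when `A` is integral over a subalgebra with `d` generators. -/
lemma exists_relation_of_isIntegral {R A : Type} [CommRing R] [CommRing A] [IsDomain A]
    [Algebra k R] [Algebra k A] [Algebra R A] [IsScalarTower k R A] {d : ℕ} (z : Fin d → R)
    [Algebra.IsIntegral (Algebra.adjoin k (Set.range z)) A] {m : ℕ} (x : Fin m → A)
    (hm : d + 1 < m) :
    ∃ G : MvPolynomial (Fin m) A, G ≠ 0 ∧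
      aeval (fun i => Polynomial.X * Polynomial.C (x i ⊗ₜ[k] (1 : A)) +
        Polynomial.C ((1 : A) ⊗ₜ[k] x i)) G = 0 := by
  set y : Fin m → Polynomial (A ⊗[k] A) := fun i =>
    Polynomial.X * Polynomial.C (x i ⊗ₜ[k] (1 : A)) + Polynomial.C ((1 : A) ⊗ₜ[k] x i) with hy
  by_contra! hG
  have hinj : Function.Injective (aeval y : MvPolynomial (Fin m) A →ₐ[A] _) :=
    (injective_iff_map_eq_zero _).2 fun G h => by_contra fun h0 => hG G h0 h
  obtain ⟨P, hP, hPc⟩ := Ideal.exists_comap_eq_of_mem_minimalPrimes_of_injective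
    (f := (aeval y : MvPolynomial (Fin m) A →ₐ[A] _).toRingHom) hinj ⊥
    (by simp [IsDomain.minimalPrimes_eq_singleton_bot])
  let D := Polynomial (A ⊗[k] A) ⧸ P
  let π : Polynomial (A ⊗[k] A) →ₐ[A] D := Ideal.Quotient.mkₐ A P
  have hind : AlgebraicIndependent A (fun i => π (y i)) := by
    refine (injective_iff_map_eq_zero _).2 fun G h => ?_
    have h1 : π (aeval y G) = 0 := by rw [← h, ← comp_aeval_apply]
    have h2 : G ∈ P.comap (aeval y : MvPolynomial (Fin m) A →ₐ[A] _).toRingHom :=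
      (Ideal.Quotient.eq_zero_iff_mem (I := P)).1 h1
    rw [hPc] at h2
    exact h2
  have : IsDomain D := Ideal.Quotient.isDomain P
  have h1 := le_of_algebraicIndependent (k := k) z (Ideal.Quotient.mkₐ_surjective A P) hind
  omega

/-- Pointwise form of `exists_relation_of_isIntegral`. -/
lemma exists_relation_at_points {R A : Type} [CommRing R] [CommRing A] [IsDomain A]
    [Algebra k R] [Algebra k A] [Algebra R A] [IsScalarTower k R A] {d : ℕ} (z : Fin d → R)
    [Algebra.IsIntegral (Algebra.adjoin k (Set.range z)) A] {m : ℕ} (x : Fin m → A)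
    (hm : d + 1 < m) :
    ∃ G : MvPolynomial (Fin m) A, G ≠ 0 ∧ ∀ (φ ψ : A →ₐ[k] k) (s : k),
      eval (fun i => s * φ (x i) + ψ (x i)) (map (φ : A →+* k) G) = 0 := by
  obtain ⟨G, hG0, hG⟩ := exists_relation_of_isIntegral (k := k) z x hm
  refine ⟨G, hG0, fun φ ψ s => ?_⟩
  let Ψ := Polynomial.eval₂RingHom (Algebra.TensorProduct.productMap φ ψ).toRingHom s
  have h := congrArg Ψ hG
  rw [map_zero, aeval_def, ← coe_eval₂Hom, ← RingHom.comp_apply, comp_eval₂Hom] at h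
  rw [eval_map, ← h, coe_eval₂Hom]
  congr 1
  · ext f
    rw [RingHom.comp_apply, Polynomial.algebraMap_apply, Algebra.TensorProduct.algebraMap_apply]
    simp [Ψ]
  · funext i
    simp [Ψ, mul_comm s]

lemma coneIdeal_le_of_subset_closure [Infinite k] {S T : Set (PS k n)} (hS : S.Nonempty)
    (hT : T.Nonempty) (h : T ⊆ closure S) : coneIdeal S ≤ coneIdeal T := by
  intro f hf
  rw [← sum_homogeneousComponent f]
  refine sum_mem fun i _ => ?_
  have hi := homogeneousComponent_isHomogeneous i f
  exact (mem_coneIdeal_iff_of_isHomogeneous hT hi).2 <| h.trans <|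
    closure_minimal ((mem_coneIdeal_iff_of_isHomogeneous hS hi).1
      (homogeneousComponent_mem_coneIdeal hf i)) (isClosed_V0 hi)

/-- Evaluation on the homogeneous coordinate ring at a point of the affine cone. -/
def coneEval {S : Set (PS k n)} {a : Fin n → k} (ha : a ∈ cone S) :
    (MvPolynomial (Fin n) k ⧸ coneIdeal S) →ₐ[k] k :=
  Ideal.Quotient.liftₐ (coneIdeal S) (aeval a) fun f hf => by
    simpa [coe_aeval_eq_eval] using mem_coneIdeal.1 hf a ha

lemma coneEval_mk {S : Set (PS k n)} {a : Fin n → k} (ha : a ∈ cone S)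
    (f : MvPolynomial (Fin n) k) : coneEval ha (Ideal.Quotient.mk _ f) = eval a f := by
  have h := DFunLike.congr_fun (Ideal.Quotient.liftₐ_comp (coneIdeal S) (aeval a : _ →ₐ[k] k)
    fun f hf => by simpa [coe_aeval_eq_eval] using mem_coneIdeal.1 hf a ha) f
  exact h.trans (by simp)

lemma exists_eval_eq_eval_map {S : Set (PS k n)} {m : ℕ}
    (G : MvPolynomial (Fin m) (MvPolynomial (Fin n) k ⧸ coneIdeal S)) (o : Fin m → k) :
    ∃ H : MvPolynomial (Fin n) k, ∀ (a : Fin n → k) (ha : a ∈ cone S),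
      eval a H = eval o (map (coneEval ha : _ →+* k) G) := by
  obtain ⟨H, hH⟩ := Ideal.Quotient.mk_surjective (eval (fun i => algebraMap k _ (o i)) G)
  refine ⟨H, fun a ha => ?_⟩
  rw [← coneEval_mk ha, hH, eval_map]
  have := eval₂_comp_left (coneEval ha : _ →+* k) (RingHom.id _) (fun i => algebraMap k _ (o i)) G
  rw [RingHom.comp_id] at this
  rw [eval, coe_eval₂Hom]
  refine (this : _).trans ?_
  congr 1
  funext i
  exact (coneEval ha).commutes (o i)

lemma le_of_forall_secant_points [IsAlgClosed k] {γ m : ℕ} {Γ : Set (PS k m)} (hc : IsClosed Γ)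
    (hi : IsIrreducible Γ) (hd : ¬ ((γ + 1 : ℕ) : WithBot ℕ∞) ≤ pdim Γ) {O : Set (PS k m)}
    (hO : IsOpen O) (hne : O.Nonempty)
    (h : ∀ o ∈ O, Γ ⊆ closure {a | a ∈ Γ ∧ ∃ b ∈ Γ, o.submodule ≤ a.submodule ⊔ b.submodule}) :
    m ≤ γ + 2 := by
  by_contra! hm
  obtain ⟨z, hz, hzΓ⟩ := exists_linear_forms (γ + 1) Γ hc hd
  have := isIntegral_quotient_coneIdeal hc hi.nonempty hz hzΓ
  have hp := coneIdeal_isPrime hi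
  obtain ⟨G, hG0, hG⟩ := exists_relation_at_points (k := k) z
    (fun i => Ideal.Quotient.mk (coneIdeal Γ) (X i)) hm
  obtain ⟨α, hα⟩ := ne_zero_iff.1 hG0
  obtain ⟨P, hP⟩ := Ideal.Quotient.mk_surjective (coeff α G)
  have hPΓ : P ∉ coneIdeal Γ := fun hmem => hα (by rw [← hP, Ideal.Quotient.eq_zero_iff_mem.2 hmem])
  obtain ⟨p, hpΓ⟩ := hi.nonempty
  obtain ⟨j, hj⟩ := Function.ne_iff.1 p.rep_nonzero
  have hjΓ : (X j : MvPolynomial (Fin m) k) ∉ coneIdeal Γ := fun hmem => hj (by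
    simpa using mem_coneIdeal.1 hmem _ (rep_mem_cone.2 hpΓ))
  have hPX : P * X j ∉ coneIdeal Γ := fun hmem => (hp.mem_or_mem hmem).elim hPΓ hjΓ
  rw [mem_coneIdeal] at hPX
  push Not at hPX
  obtain ⟨a, ha, haP⟩ := hPX
  rw [map_mul, eval_X] at haP
  have hGa : map (coneEval ha : _ →+* k) G ≠ 0 := by
    refine ne_zero_iff.2 ⟨α, ?_⟩
    rw [coeff_map, ← hP]
    exact fun e => haP (by rw [← coneEval_mk ha]; simp [show coneEval ha _ = 0 from e])
  obtain ⟨p', hp'⟩ := hne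
  obtain ⟨d, f, hf, hOf, hpf⟩ := exists_V0_of_isClosed hO.isClosed_compl (p := p') (by simpa)
  have hf0 : f ≠ 0 := by
    rintro rfl
    exact hpf fun v hv _ => map_zero _
  have hprod : map (coneEval ha : _ →+* k) G * f * X j ≠ 0 :=
    mul_ne_zero (mul_ne_zero hGa hf0) (X_ne_zero j)
  obtain ⟨o, ho⟩ : ∃ o, eval o (map (coneEval ha : _ →+* k) G * f * X j) ≠ 0 := by
    by_contra! h0
    exact hprod (MvPolynomial.funext fun v => by rw [h0 v, map_zero])
  rw [map_mul, map_mul, eval_X] at ho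
  have hoG := left_ne_zero_of_mul (left_ne_zero_of_mul ho)
  have hof := right_ne_zero_of_mul (left_ne_zero_of_mul ho)
  have ho0 : o ≠ 0 := fun e => right_ne_zero_of_mul ho (by simp [e])
  have hoO : Projectivization.mk k o ho0 ∈ O := by
    by_contra hn
    exact hof ((mk_mem_V0 hf ho0).1 (hOf hn))
  have hcl := h _ hoO
  set S := {a | a ∈ Γ ∧ ∃ b ∈ Γ, (Projectivization.mk k o ho0).submodule ≤
    a.submodule ⊔ b.submodule} with hS
  have hSne : S.Nonempty := closure_nonempty_iff.1 ⟨p, hcl hpΓ⟩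
  obtain ⟨H, hH⟩ := exists_eval_eq_eval_map G o
  have hHS : H * X j ∈ coneIdeal S := by
    refine mem_coneIdeal.2 fun v hv => ?_
    rw [map_mul, eval_X]
    by_cases hv0 : v = 0
    · simp [hv0]
    obtain ⟨hvΓ, b, hb, hob⟩ := hv hv0
    have hvc : v ∈ cone Γ := fun _ => hvΓ
    have hmem : o ∈ (Projectivization.mk k v hv0).submodule ⊔ b.submodule :=
      hob (by rw [Projectivization.submodule_mk]; exact Submodule.mem_span_singleton_self o)
    obtain ⟨x, hx, y, hy, hxy⟩ := Submodule.mem_sup.1 hmem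
    rw [Projectivization.submodule_mk] at hx
    rw [Projectivization.submodule_eq] at hy
    obtain ⟨s, rfl⟩ := Submodule.mem_span_singleton.1 hx
    obtain ⟨t, rfl⟩ := Submodule.mem_span_singleton.1 hy
    have h0 := hG (coneEval hvc) (coneEval (smul_mem_cone t (rep_mem_cone.2 hb))) s
    simp only [coneEval_mk, eval_X] at h0
    rw [hH v hvc, ← hxy, show s • v + t • b.rep = fun i => s * v i + (t • b.rep) i from rfl, h0,
      zero_mul]
  have := mem_coneIdeal.1 (coneIdeal_le_of_subset_closure hSne hi.nonempty hcl hHS) a ha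
  rw [map_mul, eval_X, hH a ha] at this
  exact mul_ne_zero hoG (right_ne_zero_of_mul haP) this

/-- A dominant polynomial map between affine varieties contains a nonempty basic open set in its
image. -/
lemma exists_basicOpen_subset_image [IsAlgClosed k] {σ τ : Type} [Finite σ] [Finite τ]
    (φ : MvPolynomial σ k →ₐ[k] MvPolynomial τ k) (J : Ideal (MvPolynomial τ k))
    (hJ : J.comap (φ : MvPolynomial σ k →+* MvPolynomial τ k) = ⊥) :
    ∃ f : MvPolynomial σ k, f ≠ 0 ∧ ∀ u, eval u f ≠ 0 →
      ∃ x ∈ zeroLocus k J, ∀ g, eval x (φ g) = eval u g := by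
  have hfin : (φ : MvPolynomial σ k →+* MvPolynomial τ k).FinitePresentation := by
    refine RingHom.FinitePresentation.of_finiteType.1 ?_
    refine RingHom.FiniteType.of_comp_finiteType (f := algebraMap k (MvPolynomial σ k)) ?_
    rw [show (φ : MvPolynomial σ k →+* MvPolynomial τ k).comp (algebraMap k _) =
      algebraMap k (MvPolynomial τ k) from φ.comp_algebraMap]
    exact RingHom.finiteType_algebraMap.2 inferInstance
  have hcon : Topology.IsConstructible (PrimeSpectrum.zeroLocus (J : Set (MvPolynomial τ k))) := by
    obtain ⟨s, hs⟩ := (isNoetherianRing_iff_ideal_fg _).1 inferInstance J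
    rw [← hs, PrimeSpectrum.zeroLocus_span, ← Topology.isConstructible_compl]
    exact (PrimeSpectrum.isRetrocompact_zeroLocus_compl s.finite_toSet).isConstructible
      (PrimeSpectrum.isClosed_zeroLocus _).isOpen_compl
  obtain ⟨D, hD⟩ := PrimeSpectrum.exists_constructibleSetData_iff.2
    (PrimeSpectrum.isConstructible_comap_image hfin hcon)
  obtain ⟨p, hp, hJp, hpc⟩ := Ideal.exists_comap_eq_of_mem_minimalPrimes (I := J)
    (φ : MvPolynomial σ k →+* MvPolynomial τ k) ⊥ (by
      rw [hJ]; simp [Ideal.minimalPrimes_eq_subsingleton_self])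
  have hbot : (⊥ : PrimeSpectrum (MvPolynomial σ k)) ∈ D.toSet := by
    rw [hD]
    exact ⟨⟨p, hp⟩, hJp, PrimeSpectrum.ext hpc⟩
  simp only [PrimeSpectrum.ConstructibleSetData.toSet, Set.mem_iUnion] at hbot
  obtain ⟨B, hB, hg, hf⟩ := hbot
  refine ⟨B.f, fun h0 => hf ?_, fun u hu => ?_⟩
  · rintro _ rfl
    simp [h0]
  have hmax : (RingHom.ker (eval u : MvPolynomial σ k →+* k)).IsMaximal :=
    RingHom.ker_isMaximal_of_surjective _ fun c => ⟨C c, eval_C c⟩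
  have hu' : (⟨_, hmax.isPrime⟩ : PrimeSpectrum (MvPolynomial σ k)) ∈ D.toSet := by
    simp only [PrimeSpectrum.ConstructibleSetData.toSet, Set.mem_iUnion]
    refine ⟨B, hB, ?_, fun h => hu (h rfl)⟩
    rintro _ ⟨i, rfl⟩
    have : B.g i = 0 := hg ⟨i, rfl⟩
    simp [this]
  rw [hD] at hu'
  obtain ⟨q, hJq, hq⟩ := hu'
  obtain ⟨M, hM, hqM⟩ := q.asIdeal.exists_le_maximal q.isPrime.ne_top
  obtain ⟨x, rfl⟩ := eq_vanishingIdeal_singleton_of_isMaximal k hM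
  have hx (g) : g ∈ vanishingIdeal k {x} ↔ eval x g = 0 := by
    rw [mem_vanishingIdeal_singleton_iff]; rfl
  refine ⟨x, fun f hf => ?_, fun g => ?_⟩
  · exact (hx f).1 (hqM (hJq hf))
  have h1 : g - C (eval u g) ∈ RingHom.ker (eval u : MvPolynomial σ k →+* k) := by
    simp [RingHom.mem_ker]
  have h2 : φ (g - C (eval u g)) ∈ q.asIdeal := by
    have := congrArg PrimeSpectrum.asIdeal hq
    rw [← show _ = RingHom.ker (eval u : MvPolynomial σ k →+* k) from this] at h1
    exact h1
  have h3 := (hx _).1 (hqM h2)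
  rw [map_sub, map_sub, sub_eq_zero] at h3
  rw [h3, ← algebraMap_eq, φ.commutes, algebraMap_eq, eval_C]

lemma exists_mem_submodule_of_mem_cone {X : Set (PS k n)} (hne : X.Nonempty) {v : Fin n → k}
    (hv : v ∈ cone X) : ∃ a ∈ X, v ∈ a.submodule := by
  by_cases hv0 : v = 0
  · obtain ⟨p, hp⟩ := hne
    exact ⟨p, hp, hv0 ▸ zero_mem _⟩
  · refine ⟨_, hv hv0, ?_⟩
    rw [Projectivization.submodule_mk]
    exact Submodule.mem_span_singleton_self v

lemma mem_cone_of_mem_submodule {X : Set (PS k n)} {a : PS k n} (ha : a ∈ X) {v : Fin n → k}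
    (hv : v ∈ a.submodule) : v ∈ cone X := by
  rw [Projectivization.submodule_eq] at hv
  obtain ⟨t, rfl⟩ := Submodule.mem_span_singleton.1 hv
  exact smul_mem_cone t (rep_mem_cone.2 ha)

lemma submodule_le_iff_rep_mem {p : PS k n} {W : Submodule k (Fin n → k)} :
    p.submodule ≤ W ↔ p.rep ∈ W := by
  rw [Projectivization.submodule_eq, Submodule.span_singleton_le_iff_mem]

lemma comp_mem_zeroLocus_of_map_rename_le {σ τ : Type} {I : Ideal (MvPolynomial σ k)}
    {J : Ideal (MvPolynomial τ k)} (ι : σ → τ)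
    (h : I.map (rename ι : MvPolynomial σ k →ₐ[k] MvPolynomial τ k) ≤ J) {x : τ → k}
    (hx : x ∈ zeroLocus k J) : x ∘ ι ∈ zeroLocus k I := fun g hg => by
  have := hx _ (h (Ideal.mem_map_of_mem _ hg))
  rwa [aeval_rename] at this

lemma exists_algHom_eval_add : ∃ φ : MvPolynomial (Fin n) k →ₐ[k] MvPolynomial (Fin n ⊕ Fin n) k,
    ∀ (x : Fin n ⊕ Fin n → k) (g : MvPolynomial (Fin n) k),
      eval x (φ g) = eval (fun i => x (Sum.inl i) + x (Sum.inr i)) g := by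
  refine ⟨aeval fun i => MvPolynomial.X (Sum.inl i) + MvPolynomial.X (Sum.inr i), fun x g => ?_⟩
  have h := comp_aeval_apply (φ := (aeval x : MvPolynomial (Fin n ⊕ Fin n) k →ₐ[k] k))
    (f := fun i : Fin n => MvPolynomial.X (R := k) (Sum.inl i : Fin n ⊕ Fin n) +
      MvPolynomial.X (Sum.inr i)) g
  simp only [map_add, aeval_X] at h
  exact h

/-- An ideal cutting out the product of the affine cone over `X` with itself. -/
lemma exists_ideal_prod (X : Set (PS k n)) : ∃ J : Ideal (MvPolynomial (Fin n ⊕ Fin n) k),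
    (∀ x ∈ zeroLocus k J, x ∘ Sum.inl ∈ zeroLocus k (coneIdeal X)) ∧
    (∀ x ∈ zeroLocus k J, x ∘ Sum.inr ∈ zeroLocus k (coneIdeal X)) ∧
    ∀ f ∈ J, ∀ v ∈ cone X, ∀ w ∈ cone X, eval (Sum.elim v w) f = 0 := by
  refine ⟨(coneIdeal X).map (rename Sum.inl : MvPolynomial (Fin n) k →ₐ[k] _) ⊔
    (coneIdeal X).map (rename Sum.inr : MvPolynomial (Fin n) k →ₐ[k] _),
    fun x hx => comp_mem_zeroLocus_of_map_rename_le Sum.inl le_sup_left hx,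
    fun x hx => comp_mem_zeroLocus_of_map_rename_le Sum.inr le_sup_right hx,
    fun f hf v hv w hw => ?_⟩
  have : (coneIdeal X).map (rename Sum.inl : MvPolynomial (Fin n) k →ₐ[k] _) ⊔
      (coneIdeal X).map (rename Sum.inr : MvPolynomial (Fin n) k →ₐ[k] _) ≤
      RingHom.ker (eval (Sum.elim v w) : MvPolynomial (Fin n ⊕ Fin n) k →+* k) := by
    refine sup_le (Ideal.map_le_iff_le_comap.2 fun g hg => ?_)
      (Ideal.map_le_iff_le_comap.2 fun g hg => ?_)
    · simpa [RingHom.mem_ker, eval_rename] using mem_coneIdeal.1 hg v hv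
    · simpa [RingHom.mem_ker, eval_rename] using mem_coneIdeal.1 hg w hw
  exact this hf

lemma coneIdeal_eq_bot_of_dense [Infinite k] {D : Set (PS k n)} (hD : Dense D)
    (hne : D.Nonempty) : coneIdeal D = ⊥ := by
  have h : coneIdeal D ≤ coneIdeal Set.univ :=
    coneIdeal_le_of_subset_closure hne (hne.mono (Set.subset_univ _))
      (by rw [hD.closure_eq])
  rw [eq_bot_iff]
  exact h.trans (by rw [coneIdeal_univ])

/-- If the cone over `X` contains the summands of `t • q` for `q` outside a proper affine
hypersurface, then the secant lines of `X` contain a nonempty open set. -/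
lemma exists_isOpen_of_forall_eval_ne_zero [IsAlgClosed k] {X : Set (PS k n)}
    (hne : X.Nonempty) {f : MvPolynomial (Fin n) k} (hf0 : f ≠ 0)
    (hf : ∀ u, eval u f ≠ 0 → ∃ v ∈ cone X, ∃ w ∈ cone X, u = v + w) :
    ∃ U : Set (PS k n), IsOpen U ∧ U.Nonempty ∧
      ∀ q ∈ U, ∃ a ∈ X, ∃ b ∈ X, q.submodule ≤ a.submodule ⊔ b.submodule := by
  obtain ⟨p, hp⟩ := id hne
  obtain ⟨j, hj⟩ := Function.ne_iff.1 p.rep_nonzero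
  have hfX : f * MvPolynomial.X j ≠ 0 := mul_ne_zero hf0 (X_ne_zero j)
  obtain ⟨d, hd⟩ : ∃ d, homogeneousComponent d (f * MvPolynomial.X j) ≠ 0 := by
    by_contra! h
    exact hfX (by rw [← sum_homogeneousComponent (f * MvPolynomial.X j)]; simp [h])
  have hhom := homogeneousComponent_isHomogeneous d (f * MvPolynomial.X j)
  refine ⟨(V0 (homogeneousComponent d (f * MvPolynomial.X j)))ᶜ,
    (isClosed_V0 hhom).isOpen_compl, ?_, fun q hq => ?_⟩
  · obtain ⟨v, hv⟩ : ∃ v, eval v (homogeneousComponent d (f * MvPolynomial.X j) *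
        MvPolynomial.X j) ≠ 0 := by
      by_contra! h0
      exact mul_ne_zero hd (X_ne_zero j) (MvPolynomial.funext fun v => by rw [h0 v, map_zero])
    rw [map_mul, eval_X] at hv
    have hv0 : v ≠ 0 := fun e => right_ne_zero_of_mul hv (by simp [e])
    exact ⟨_, fun hm => left_ne_zero_of_mul hv ((mk_mem_V0 hhom hv0).1 hm)⟩
  · rw [Set.mem_compl_iff, mem_V0_iff_rep hhom] at hq
    obtain ⟨t, ht⟩ : ∃ t : k, eval (t • q.rep) (f * MvPolynomial.X j) ≠ 0 := by
      by_contra! h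
      exact hq (eval_homogeneousComponent_eq_zero h d)
    rw [map_mul, eval_X] at ht
    have ht0 : t ≠ 0 := by
      rintro rfl
      exact right_ne_zero_of_mul ht (by simp)
    obtain ⟨v, hv, w, hw, hvw⟩ := hf _ (left_ne_zero_of_mul ht)
    obtain ⟨a, ha, hva⟩ := exists_mem_submodule_of_mem_cone hne hv
    obtain ⟨b, hb, hwb⟩ := exists_mem_submodule_of_mem_cone hne hw
    refine ⟨a, ha, b, hb, submodule_le_iff_rep_mem.2 ?_⟩
    rw [← inv_smul_smul₀ ht0 q.rep, hvw]
    exact Submodule.smul_mem _ _ (Submodule.add_mem_sup hva hwb)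

/-- If the points on lines spanned by two points of `X` are dense, they contain a nonempty open
set. -/
lemma exists_isOpen_subset_secant_points [IsAlgClosed k] {X : Set (PS k n)} (hX : IsClosed X)
    (hne : X.Nonempty)
    (hD : Dense {q : PS k n | ∃ a ∈ X, ∃ b ∈ X, q.submodule ≤ a.submodule ⊔ b.submodule}) :
    ∃ U : Set (PS k n), IsOpen U ∧ U.Nonempty ∧
      ∀ q ∈ U, ∃ a ∈ X, ∃ b ∈ X, q.submodule ≤ a.submodule ⊔ b.submodule := by
  obtain ⟨p, hp⟩ := id hne
  have hDne : {q : PS k n | ∃ a ∈ X, ∃ b ∈ X, q.submodule ≤ a.submodule ⊔ b.submodule}.Nonempty :=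
    ⟨p, p, hp, p, hp, le_sup_left⟩
  have hbot := coneIdeal_eq_bot_of_dense hD hDne
  obtain ⟨φ, hφ⟩ := exists_algHom_eval_add (k := k) (n := n)
  obtain ⟨J, hJl, hJr, hJ⟩ := exists_ideal_prod X
  have hcomap : J.comap (φ : MvPolynomial (Fin n) k →+* MvPolynomial (Fin n ⊕ Fin n) k) = ⊥ := by
    refine (Submodule.eq_bot_iff _).2 fun g hg => ?_
    rw [← Ideal.mem_bot, ← hbot, mem_coneIdeal]
    intro v hv
    obtain ⟨q, ⟨a, ha, b, hb, hq⟩, hvq⟩ :=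
      exists_mem_submodule_of_mem_cone hDne hv
    obtain ⟨x, hx, y, hy, rfl⟩ := Submodule.mem_sup.1 (hq hvq)
    have h0 := hJ (φ g) hg x (mem_cone_of_mem_submodule ha hx) y (mem_cone_of_mem_submodule hb hy)
    rw [hφ] at h0
    exact h0
  obtain ⟨f, hf0, hf⟩ := exists_basicOpen_subset_image φ J hcomap
  refine exists_isOpen_of_forall_eval_ne_zero hne hf0 fun u hu => ?_
  obtain ⟨x, hx, hxg⟩ := hf u hu
  refine ⟨x ∘ Sum.inl, ?_, x ∘ Sum.inr, ?_, funext fun i => ?_⟩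
  · rw [← zeroLocus_coneIdeal hX hne]
    exact hJl x hx
  · rw [← zeroLocus_coneIdeal hX hne]
    exact hJr x hx
  · have := hxg (MvPolynomial.X i)
    rw [hφ, eval_X, eval_X] at this
    exact this.symm

lemma pspan_pair (a b : PS k n) : pspan {a, b} = a.submodule ⊔ b.submodule := by
  rw [pspan, iSup_pair]

lemma eq_of_submodule_le {p q : PS k n} (h : p.submodule ≤ q.submodule) : p = q := by
  refine Projectivization.submodule_injective (Submodule.eq_of_le_of_finrank_eq h ?_)
  rw [p.finrank_submodule, q.finrank_submodule]

/-- The points of `Γ` lying on a line through `o` and a further point of `Γ`. -/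
def secantPoints (Γ : Set (PS k n)) (o : PS k n) : Set (PS k n) :=
  {a | a ∈ Γ ∧ ∃ b ∈ Γ, b ≠ a ∧ o.submodule ≤ a.submodule ⊔ b.submodule}

lemma secantPoints_mono {Γ X : Set (PS k n)} (h : Γ ⊆ X) (o : PS k n) :
    secantPoints Γ o ⊆ secantPoints X o :=
  fun _ ⟨ha, b, hb, hab⟩ => ⟨h ha, b, h hb, hab⟩

section Map

variable {m : ℕ} (φ : (Fin m → k) →ₗ[k] (Fin n → k)) (hφ : Function.Injective φ)

lemma image_secantPoints (Γ : Set (PS k m)) (o : PS k m) :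
    Projectivization.map φ hφ '' secantPoints Γ o =
      secantPoints (Projectivization.map φ hφ '' Γ) (Projectivization.map φ hφ o) := by
  ext x
  constructor
  · rintro ⟨a, ⟨ha, b, hb, hab, h⟩, rfl⟩
    exact ⟨⟨a, ha, rfl⟩, _, ⟨b, hb, rfl⟩, (isEmbedding_map φ hφ).injective.ne hab,
      (map_incidence φ hφ).2 h⟩
  · rintro ⟨⟨a, ha, rfl⟩, _, ⟨b, hb, rfl⟩, hab, h⟩
    exact ⟨a, ⟨ha, b, hb, fun e => hab (e ▸ rfl), (map_incidence φ hφ).1 h⟩, rfl⟩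

lemma image_subset_closure_secantPoints_iff {Γ : Set (PS k m)} {o : PS k m} :
    Projectivization.map φ hφ '' Γ ⊆ closure
        (secantPoints (Projectivization.map φ hφ '' Γ) (Projectivization.map φ hφ o)) ↔
      Γ ⊆ closure (secantPoints Γ o) := by
  rw [← image_secantPoints, Set.image_subset_iff,
    (isInducing_map φ hφ).closure_eq_preimage_closure_image]

end Map

lemma subset_linSet_pspan (S : Set (PS k n)) : S ⊆ linSet (pspan S) :=
  fun p hp => show p.submodule ≤ _ from
    le_iSup₂_of_le (f := fun q (_ : q ∈ S) => Projectivization.submodule q) p hp le_rfl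

/-- A closed set is the image of a closed set in its span. -/
lemma exists_eq_image {Γ : Set (PS k n)} (hc : IsClosed Γ) {m : ℕ}
    (hm : Module.finrank k (pspan Γ) = m) :
    ∃ (φ : (Fin m → k) →ₗ[k] (Fin n → k)) (hφ : Function.Injective φ) (Γ' : Set (PS k m)),
      IsClosed Γ' ∧ Projectivization.map φ hφ '' Γ' = Γ ∧
        Set.range (Projectivization.map φ hφ) = linSet (pspan Γ) ∧ pspan Γ' = ⊤ := by
  obtain ⟨φ, hφ, hr⟩ := exists_parametrization _ hm
  have hran : Set.range (Projectivization.map φ hφ) = linSet (pspan Γ) := by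
    rw [range_map, hr]
  have him : Projectivization.map φ hφ '' (Projectivization.map φ hφ ⁻¹' Γ) = Γ :=
    Set.image_preimage_eq_of_subset (hran ▸ subset_linSet_pspan Γ)
  refine ⟨φ, hφ, _, hc.preimage (isInducing_map φ hφ).continuous, him, hran, ?_⟩
  have := pspan_image φ hφ (Projectivization.map φ hφ ⁻¹' Γ)
  rw [him] at this
  refine Submodule.map_injective_of_injective hφ ?_
  rw [← this, Submodule.map_top, hr]

/-- If `Γ` is a hypersurface in its span, every point `o` of the span outside `Γ` lies on secant
lines through a general point of `Γ`. -/
lemma subset_closure_secantPoints [IsAlgClosed k] [CharZero k] {γ : ℕ} {Γ : Set (PS k n)}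
    (hc : IsClosed Γ) (hi : IsIrreducible Γ) (hd : (γ : WithBot ℕ∞) ≤ pdim Γ)
    (hm : Module.finrank k (pspan Γ) = γ + 2) {o : PS k n} (ho : o ∉ Γ)
    (hoΓ : o ∈ linSet (pspan Γ)) : Γ ⊆ closure (secantPoints Γ o) := by
  obtain ⟨φ, hφ, Γ, hc', rfl, hran, hsp⟩ := exists_eq_image hc hm
  rw [← hran] at hoΓ
  obtain ⟨o, rfl⟩ := hoΓ
  rw [image_subset_closure_secantPoints_iff]
  rw [pdim_image] at hd
  exact subset_closure_secant_points hc' (isIrreducible_of_image (isInducing_map φ hφ) hi) hd hsp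
    fun h => ho ⟨o, h, rfl⟩

/-- If a general point of the span of `Γ` lies on secant lines through a general point of `Γ`,
then `Γ` has codimension at most one in its span. -/
lemma finrank_pspan_le [IsAlgClosed k] {γ : ℕ} {Γ : Set (PS k n)}
    (hc : IsClosed Γ) (hi : IsIrreducible Γ) (hd : ¬ ((γ + 1 : ℕ) : WithBot ℕ∞) ≤ pdim Γ)
    {O : Set (PS k n)} (hO : IsOpen O) (hne : (linSet (pspan Γ) ∩ O).Nonempty)
    (h : ∀ o ∈ linSet (pspan Γ) ∩ O, Γ ⊆ closure (secantPoints Γ o)) :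
    Module.finrank k (pspan Γ) ≤ γ + 2 := by
  generalize hm : Module.finrank k (pspan Γ) = m
  obtain ⟨φ, hφ, Γ', hc', hΓ, hran, -⟩ := exists_eq_image hc hm
  rw [← hran] at hne h
  rw [← hΓ, pdim_image] at hd
  obtain ⟨_, ⟨o, rfl⟩, hoO⟩ := hne
  refine le_of_forall_secant_points hc'
    (isIrreducible_of_image (isInducing_map φ hφ) (hΓ.symm ▸ hi)) hd
    (hO.preimage (isInducing_map φ hφ).continuous) ⟨o, hoO⟩ fun o ho => ?_
  have := h _ ⟨⟨o, rfl⟩, ho⟩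
  rw [← hΓ, image_subset_closure_secantPoints_iff] at this
  exact this.trans (closure_mono fun a ⟨ha, b, hb, _, hab⟩ => ⟨ha, b, hb, hab⟩)

/-- A closed set different from its span has dimension less than its span. -/
lemma le_finrank_pspan [IsAlgClosed k] {γ : ℕ} {Γ : Set (PS k n)} (hc : IsClosed Γ)
    (hd : (γ : WithBot ℕ∞) ≤ pdim Γ) {q : PS k n} (hq : q ∉ Γ) (hqΓ : q ∈ linSet (pspan Γ)) :
    γ + 2 ≤ Module.finrank k (pspan Γ) := by
  generalize hm : Module.finrank k (pspan Γ) = m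
  obtain ⟨φ, hφ, Γ', hc', hΓ, hran, -⟩ := exists_eq_image hc hm
  rw [← hran] at hqΓ
  obtain ⟨q, rfl⟩ := hqΓ
  rw [← hΓ, pdim_image] at hd
  have hne : (Set.univ : Set (PS k m)).Nonempty := ⟨q, trivial⟩
  refine add_one_le_of_le_pdim_univ (k := k) (pdim_lt_of_ssubset hc' isClosed_univ
    ⟨hne, PreirreducibleSpace.isPreirreducible_univ⟩
    ((Set.ssubset_univ_iff).2 fun e => hq (hΓ ▸ ⟨q, by rw [e]; trivial, rfl⟩)) hd)

lemma isIrreducible_linSet [Infinite k] {W : Submodule k (Fin n → k)}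
    (hne : (linSet W).Nonempty) : IsIrreducible (linSet W) := by
  refine ⟨hne, ?_⟩
  obtain ⟨φ, hφ, hr⟩ := exists_parametrization W rfl
  rw [← hr, ← range_map φ hφ, ← Set.image_univ]
  exact PreirreducibleSpace.isPreirreducible_univ.image _
    (isInducing_map φ hφ).continuous.continuousOn

lemma hasDecomp_two_iff {X : Set (PS k n)} {q : PS k n} :
    hasDecomp X q 2 ↔ ∃ a ∈ X, ∃ b ∈ X, a ≠ b ∧ q.submodule ≤ a.submodule ⊔ b.submodule := by
  classical
  constructor
  · rintro ⟨A, hA, hc, hq⟩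
    obtain ⟨a, b, hab, rfl⟩ := Finset.card_eq_two.1 hc
    rw [Finset.coe_pair] at hA hq
    exact ⟨a, hA (by simp), b, hA (by simp), hab, by rwa [← pspan_pair]⟩
  · rintro ⟨a, ha, b, hb, hab, hq⟩
    refine ⟨{a, b}, ?_, Finset.card_pair hab, ?_⟩
    · rw [Finset.coe_pair]
      exact Set.pair_subset ha hb
    · rw [memSpan, Finset.coe_pair, pspan_pair]
      exact hq

lemma hasDecomp_one_iff {X : Set (PS k n)} {q : PS k n} : hasDecomp X q 1 ↔ q ∈ X := by
  constructor
  · rintro ⟨A, hA, hc, hq⟩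
    obtain ⟨a, rfl⟩ := Finset.card_eq_one.1 hc
    rw [Finset.coe_singleton] at hA hq
    rw [memSpan, pspan, iSup_singleton] at hq
    exact eq_of_submodule_le hq ▸ hA rfl
  · intro hq
    refine ⟨{q}, by simpa using hq, rfl, ?_⟩
    rw [memSpan, pspan, Finset.coe_singleton, iSup_singleton]

lemma not_hasDecomp_zero {X : Set (PS k n)} {q : PS k n} : ¬ hasDecomp X q 0 := by
  rintro ⟨A, hA, hc, hq⟩
  obtain rfl := Finset.card_eq_zero.1 hc
  have h1 := submodule_le_iff_rep_mem.1 hq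
  exact q.rep_nonzero (by simpa [pspan] using h1)

lemma not_memSpan_of_card_le_one {X : Set (PS k n)} {q : PS k n} (hq : q ∉ X)
    {B : Finset (PS k n)} (hB : (B : Set (PS k n)) ⊆ X) (hc : B.card ≤ 1) : ¬ memSpan q B := by
  intro h
  obtain h0 | h1 := Nat.le_one_iff_eq_zero_or_eq_one.1 hc
  · exact not_hasDecomp_zero (X := X) ⟨B, hB, h0, h⟩
  · exact hq (hasDecomp_one_iff.1 ⟨B, hB, h1, h⟩)

lemma rk_eq_two {X : Set (PS k n)} {q : PS k n} (hq : q ∉ X) (h : hasDecomp X q 2) :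
    rk X q = 2 := by
  refine le_antisymm (Nat.sInf_le h) (le_csInf ⟨2, h⟩ fun s hs => ?_)
  obtain ⟨A, hA, rfl, hs⟩ := hs
  by_contra! hlt
  exact not_memSpan_of_card_le_one hq hA (by omega) hs

/-- For points of rank two the entry locus is the closure of the set of points on secant lines. -/
lemma entryLocus_eq {X : Set (PS k n)} {q : PS k n} (hq : q ∉ X) (h : hasDecomp X q 2) :
    entryLocus X q = closure (secantPoints X q) := by
  classical
  unfold entryLocus
  congr 1
  ext a
  simp only [Set.mem_iUnion, Finset.mem_coe, exists_prop]
  constructor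
  · rintro ⟨A, ⟨hA, hc, hm, -⟩, ha⟩
    rw [rk_eq_two hq h] at hc
    obtain ⟨x, y, hxy, rfl⟩ := Finset.card_eq_two.1 hc
    rw [Finset.coe_pair] at hA
    rw [memSpan, Finset.coe_pair, pspan_pair] at hm
    have hx : x ∈ X := hA (by simp)
    have hy : y ∈ X := hA (by simp)
    rcases Finset.mem_insert.1 ha with rfl | ha
    · exact ⟨hx, y, hy, hxy.symm, hm⟩
    · obtain rfl := Finset.mem_singleton.1 ha
      exact ⟨hy, x, hx, hxy, sup_comm x.submodule _ ▸ hm⟩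
  · rintro ⟨ha, b, hb, hab, hm⟩
    have hsub : (({a, b} : Finset (PS k n)) : Set (PS k n)) ⊆ X := by
      rw [Finset.coe_pair]
      exact Set.pair_subset ha hb
    have hc : ({a, b} : Finset (PS k n)).card = 2 := Finset.card_pair hab.symm
    refine ⟨{a, b}, ⟨hsub, hc.trans (rk_eq_two hq h).symm, ?_, fun B hB => ?_⟩, by simp⟩
    · rw [memSpan, Finset.coe_pair, pspan_pair]
      exact hm
    · have := Finset.card_lt_card hB
      exact not_memSpan_of_card_le_one hq
        ((Finset.coe_subset.2 hB.subset).trans hsub) (by omega)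

lemma subset_closure_secantPoints_entryLocus {X : Set (PS k n)} {q : PS k n} (hq : q ∉ X)
    (h : hasDecomp X q 2) :
    entryLocus X q ⊆ closure (secantPoints (entryLocus X q) q) := by
  rw [entryLocus_eq hq h]
  refine closure_mono fun a ha => ?_
  obtain ⟨haX, b, hb, hab, hm⟩ := ha
  exact ⟨subset_closure ⟨haX, b, hb, hab, hm⟩, b,
    subset_closure ⟨hb, a, haX, hab.symm, sup_comm a.submodule _ ▸ hm⟩, hab, hm⟩

lemma mem_linSet_pspan_entryLocus {X : Set (PS k n)} {q : PS k n} (hq : q ∉ X)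
    (h : hasDecomp X q 2) : q ∈ linSet (pspan (entryLocus X q)) := by
  obtain ⟨a, ha, b, hb, hab, hm⟩ := hasDecomp_two_iff.1 h
  rw [entryLocus_eq hq h]
  refine hm.trans (sup_le (subset_linSet_pspan _ (subset_closure ?_))
    (subset_linSet_pspan _ (subset_closure ?_)))
  · exact ⟨ha, b, hb, hab.symm, hm⟩
  · exact ⟨hb, a, ha, hab, sup_comm a.submodule _ ▸ hm⟩

lemma entryLocus_subset {X : Set (PS k n)} (hX : IsClosed X) (q : PS k n) :
    entryLocus X q ⊆ X :=
  closure_minimal (Set.iUnion₂_subset fun _ hA => hA.1) hX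

/-- If `X` has generic rank two, a general point lies outside `X` and on a line joining two
points of `X`. -/
lemma generic_hasDecomp_two [IsAlgClosed k] {X : Set (PS k n)} (hX : IsClosed X)
    (hne : X.Nonempty) (hnd : Nondeg X) (hs : rgen X = 2) :
    Generic fun q : PS k n => q ∉ X ∧ hasDecomp X q 2 := by
  have htop : linSet (pspan X) = Set.univ := by
    rw [hnd]
    exact Set.eq_univ_of_forall fun p => show p.submodule ≤ ⊤ from le_top
  have hXu : X ≠ Set.univ := by
    intro e
    have : (1 : ℕ) < rgen X := by omega
    refine Nat.notMem_of_lt_sInf this ?_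
    change secant X 1 = _
    rw [htop, secant]
    simp_rw [hasDecomp_one_iff]
    exact hX.closure_eq.trans e
  have h2 : secant X 2 = Set.univ := by
    have : rgen X ∈ {s | secant X s = linSet (pspan X)} :=
      Nat.sInf_mem (Nat.nonempty_of_pos_sInf (by change 0 < rgen X; omega))
    rw [hs] at this
    exact this.trans htop
  obtain ⟨U, hU, hUne, h⟩ := exists_isOpen_subset_secant_points hX hne
    ((dense_iff_closure_eq.2 h2).mono fun q hq => by
      obtain ⟨a, ha, b, hb, -, h⟩ := hasDecomp_two_iff.1 hq
      exact ⟨a, ha, b, hb, h⟩)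
  refine ⟨U ∩ Xᶜ, hU.inter hX.isOpen_compl, ?_, fun q hq => ⟨hq.2, ?_⟩⟩
  · exact (hU.inter hX.isOpen_compl).dense (nonempty_preirreducible_inter hU hX.isOpen_compl hUne
      (Set.nonempty_compl.2 hXu))
  · obtain ⟨a, ha, b, hb, hm⟩ := h q hq.1
    refine hasDecomp_two_iff.2 ⟨a, ha, b, hb, ?_, hm⟩
    rintro rfl
    rw [sup_idem] at hm
    exact hq.2 (eq_of_submodule_le hm ▸ ha)

lemma Generic.and {P Q : PS k n → Prop} (hP : Generic P) (hQ : Generic Q) :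
    Generic fun q => P q ∧ Q q := by
  obtain ⟨U, hU, hUd, hP⟩ := hP
  obtain ⟨V, hV, hVd, hQ⟩ := hQ
  exact ⟨U ∩ V, hU.inter hV, hUd.inter_of_isOpen_left hVd hU,
    fun q hq => ⟨hP q hq.1, hQ q hq.2⟩⟩

end EL

open EL in
/-- If `X` has generic rank 2 and is of type I, then `X` is of type A iff
`ℓ(X) = γ(X) + 1`, i.e. the general entry locus is a hypersurface in its span. -/
theorem statement8 {k : Type} [Field k] [IsAlgClosed k] [CharZero k]
    (r γ ℓ : ℕ) (X : Set (PS k (r+1))) (hX : IsVariety X) (hnd : Nondeg X)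
    (hs : rgen X = 2) (hI : TypeI X)
    (hgl : Generic (fun q : PS k (r+1) =>
      pdim (entryLocus X q) = (γ : WithBot ℕ∞) ∧ spanDim (entryLocus X q) = ℓ)) :
    (TypeA X ↔ ℓ = γ + 1) := by
  obtain ⟨U, hU, hUd, h⟩ :=
    (generic_hasDecomp_two hX.1 hX.2.1 hnd hs).and (hI.and hgl)
  have hdim {q} (hq : q ∈ U) : ¬ ((γ + 1 : ℕ) : WithBot ℕ∞) ≤ pdim (entryLocus X q) := by
    rw [(h q hq).2.2.1]
    exact_mod_cast Nat.not_succ_le_self γ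
  have hfin {q} (hq : q ∈ U) : γ + 2 ≤ Module.finrank k (pspan (entryLocus X q)) :=
    le_finrank_pspan isClosed_closure (h q hq).2.2.1.ge
      (fun hqΓ => (h q hq).1.1 (entryLocus_subset hX.1 q hqΓ))
      (mem_linSet_pspan_entryLocus (h q hq).1.1 (h q hq).1.2)
  constructor
  · rintro ⟨V, hV, hVd, hA⟩
    obtain ⟨p, -⟩ := hX.2.1
    have : Nonempty (PS k (r + 1)) := ⟨p⟩
    obtain ⟨q, hqU, hqV⟩ := (hUd.inter_of_isOpen_left hVd hU).nonempty
    obtain ⟨W, hW, hWd, hWA⟩ := hA q hqV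
    have hq := mem_linSet_pspan_entryLocus (h q hqU).1.1 (h q hqU).1.2
    obtain ⟨o, hoU, hoΛ, hoW⟩ := mem_closure_iff.1 (hWd hq) U hU hqU
    have hle := finrank_pspan_le isClosed_closure (h q hqU).2.1 (hdim hqU) (hW.inter hU)
      ⟨o, hoΛ, hoW, hoU⟩ fun o ho => by
        have := subset_closure_secantPoints_entryLocus (h o ho.2.2).1.1 (h o ho.2.2).1.2
        rwa [hWA o ⟨ho.1, ho.2.1⟩] at this
    have := hfin hqU
    have hl := (h q hqU).2.2.2
    rw [spanDim] at hl
    change Module.finrank k (pspan (entryLocus X q)) ≤ γ + 2 at hle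
    omega
  · rintro rfl
    refine ⟨U, hU, hUd, fun q hqU => ⟨U, hU, ?_, fun o ⟨hoΛ, hoU⟩ => ?_⟩⟩
    · have hq := mem_linSet_pspan_entryLocus (h q hqU).1.1 (h q hqU).1.2
      exact subset_closure_inter_of_isPreirreducible_of_isOpen
        (isIrreducible_linSet ⟨q, hq⟩).2 hU ⟨q, hq, hqU⟩
    · have hm : Module.finrank k (pspan (entryLocus X q)) = γ + 2 := by
        have := hfin hqU
        have hl := (h q hqU).2.2.2
        rw [spanDim] at hl
        omega
      have hsub : entryLocus X q ⊆ entryLocus X o := by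
        refine (subset_closure_secantPoints isClosed_closure (h q hqU).2.1
          (h q hqU).2.2.1.ge hm
          (fun ho => (h o hoU).1.1 (entryLocus_subset hX.1 q ho)) hoΛ).trans ?_
        rw [entryLocus_eq (h o hoU).1.1 (h o hoU).1.2]
        exact closure_mono (secantPoints_mono (entryLocus_subset hX.1 q) o)
      by_contra hne
      exact hdim hoU (pdim_lt_of_ssubset isClosed_closure isClosed_closure (h o hoU).2.1
        (hsub.ssubset_of_ne (Ne.symm hne)) (h q hqU).2.2.1.ge)
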